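/- arXiv:1809.10737 — 4 statements merged into one kernel-verified Lean document; each statement's English description precedes it below -/
import Mathlib

section
/- Let k ≥ 2 be a fixed integer, and let r : ℕ → ℝ be a positive function with r(n)·n^{k/(2k−2)} → ∞ as n → ∞. Then the probability that the random geometric graph G(n, r(n)) contains a clique of size k (k vertices that are pairwise adjacent) tends to 1 as n → ∞. -/
open MeasureTheory Filter

noncomputable section

/-- The unit square `[0,1]²` in the Euclidean plane. -/
def unitSquare : Set (EuclideanSpace ℝ (Fin 2)) := {x | ∀ i, x i ∈ Set.Icc (0 : ℝ) 1}

/-- The distribution of `n` independent uniform points in the unit square. -/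
def sqMeasure (n : ℕ) : Measure (Fin n → EuclideanSpace ℝ (Fin 2)) :=
  Measure.pi fun _ => volume.restrict unitSquare

/-- The random geometric graph on `n` points `x 0, …, x (n-1)` with distance parameter `r`:
distinct `i`, `j` are adjacent iff `dist (x i) (x j) ≤ r`. -/
def geomGraph (n : ℕ) (r : ℝ) (x : Fin n → EuclideanSpace ℝ (Fin 2)) : SimpleGraph (Fin n) where
  Adj i j := i ≠ j ∧ dist (x i) (x j) ≤ r
  symm := ⟨fun i j h => ⟨h.1.symm, by rw [dist_comm]; exact h.2⟩⟩
  loopless := ⟨fun i h => h.1 rfl⟩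

def bcount (k N m : ℕ) : ℕ :=
  (Finset.univ.filter fun L : Fin m → Fin N =>
    ∀ c, (Finset.univ.filter fun i => L i = c).card < k).card

theorem bcount_type (k N : ℕ) (α : Type) [Fintype α] [DecidableEq α] :
    (Finset.univ.filter fun L : α → Fin N =>
      ∀ c, (Finset.univ.filter fun i => L i = c).card < k).card = bcount k N (Fintype.card α) := by
  unfold bcount
  let e := Fintype.equivFin α
  refine Finset.card_bij (fun L _ => L ∘ e.symm) ?_ ?_ ?_
  · intro L hL
    simp only [Finset.mem_filter, Finset.mem_univ, true_and] at hL ⊢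
    intro c
    refine lt_of_le_of_lt (le_of_eq ?_) (hL c)
    refine Finset.card_bij (fun i _ => e.symm i) ?_ ?_ ?_
    · intro a ha; simpa using ha
    · intro a _ b _ h; simpa using h
    · intro b hb; exact ⟨e b, by simpa using hb, by simp⟩
  · intro a _ b _ h
    funext i
    have := congrFun h (e i)
    simpa using this
  · intro L hL
    refine ⟨L ∘ e, ?_, by funext i; simp⟩
    simp only [Finset.mem_filter, Finset.mem_univ, true_and] at hL ⊢
    intro c
    refine lt_of_le_of_lt (le_of_eq ?_) (hL c)
    refine Finset.card_bij (fun i _ => e i) ?_ ?_ ?_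
    · intro a ha; simpa using ha
    · intro a _ b _ h; simpa using h
    · intro b hb; exact ⟨e.symm b, by simpa using hb, by simp⟩

theorem bcount_rec (k N m : ℕ) :
    bcount k (N+1) m ≤ ∑ j ∈ Finset.range (m+1), m.choose j * (if j < k then bcount k N (m - j) else 0) := by
  have h0 := Finset.sum_powerset_apply_card (fun j => if j < k then bcount k N (m - j) else 0)
    (x := (Finset.univ : Finset (Fin m)))
  simp only [Finset.card_univ, Fintype.card_fin, smul_eq_mul] at h0
  rw [← h0]
  conv_lhs => unfold bcount
  rw [Finset.card_eq_sum_card_fiberwise (f := fun L : Fin m → Fin (N+1) =>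
    Finset.univ.filter fun i => L i = Fin.last N) (t := (Finset.univ : Finset (Fin m)).powerset)
    (by intro L _; simp)]
  refine Finset.sum_le_sum fun T _ => ?_
  split_ifs with hT
  · have hc : Fintype.card {i // i ∉ T} = m - T.card := by
      simp [Fintype.card_subtype_compl]
    rw [← hc, ← bcount_type]
    have key : ∀ L : Fin m → Fin (N+1), Finset.univ.filter (fun i => L i = Fin.last N) = T →
        ∀ i : {i // i ∉ T}, L i ≠ Fin.last N := by
      intro L h i hi
      have : (i : Fin m) ∈ Finset.univ.filter (fun i => L i = Fin.last N) := by simpa using hi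
      exact i.2 (h ▸ this)
    refine Finset.card_le_card_of_surjOn
      (fun L' : {i // i ∉ T} → Fin N => fun i : Fin m =>
        if h : i ∈ T then Fin.last N else (L' ⟨i, h⟩).castSucc) ?_
    intro L hL
    simp only [Finset.coe_filter, Finset.mem_filter, Finset.mem_univ, true_and,
      Set.mem_ofPred_eq] at hL
    obtain ⟨hg, hLT⟩ := hL
    refine ⟨fun i => (L i).castPred (key L hLT i), ?_, ?_⟩
    · simp only [Finset.coe_filter, Finset.mem_univ, true_and, Set.mem_ofPred_eq]
      intro c
      refine lt_of_le_of_lt ?_ (hg c.castSucc)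
      refine Finset.card_le_card_of_injOn Subtype.val ?_ Subtype.val_injective.injOn
      intro i hi
      simp only [Finset.coe_filter, Finset.mem_univ, true_and, Set.mem_ofPred_eq] at hi ⊢
      rw [← hi]; simp
    · funext i
      by_cases h : i ∈ T
      · have h' := h
        rw [← hLT] at h'
        simp only [Finset.mem_filter, Finset.mem_univ, true_and] at h'
        simp [h, h']
      · simp [h]
  · refine le_of_eq ?_
    rw [Finset.card_eq_zero, Finset.filter_eq_empty_iff]
    intro L hL h
    simp only [Finset.mem_filter, Finset.mem_univ, true_and] at hL
    exact hT (h ▸ hL (Fin.last N))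

theorem bcount_succ (k N m : ℕ) : bcount k N (m+1) ≤ N * bcount k N m := by
  unfold bcount
  have : N * (Finset.univ.filter fun L : Fin m → Fin N =>
    ∀ c, (Finset.univ.filter fun i => L i = c).card < k).card = 
    ((Finset.univ : Finset (Fin N)) ×ˢ (Finset.univ.filter fun L : Fin m → Fin N =>
    ∀ c, (Finset.univ.filter fun i => L i = c).card < k)).card := by simp [Finset.card_product]
  rw [this]
  refine Finset.card_le_card_of_injOn (fun L => (L 0, fun i => L i.succ)) ?_ ?_
  · intro L hL
    simp only [Finset.coe_filter, Finset.mem_univ, true_and, Set.mem_ofPred_eq, Finset.coe_product, Set.mem_prod, Finset.coe_univ, Set.mem_univ] at hL ⊢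
    intro c
    refine lt_of_le_of_lt ?_ (hL c)
    refine Finset.card_le_card_of_injOn Fin.succ ?_ (Fin.succ_injective _).injOn
    intro i hi; simpa using hi
  · intro a _ b _ h
    simp only [Prod.mk.injEq] at h
    funext i
    refine Fin.cases h.1 (fun i => congrFun h.2 i) i

theorem bcount_mono (k N m d : ℕ) : bcount k N (m+d) ≤ N^d * bcount k N m := by
  induction d with
  | zero => simp
  | succ d ih =>
    calc _ ≤ N * bcount k N (m+d) := bcount_succ k N (m+d)
      _ ≤ N * (N^d * bcount k N m) := Nat.mul_le_mul_left _ ih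
      _ = _ := by ring

theorem bcount_gf (k N n : ℕ) (z : ℝ) (hz : 0 ≤ z) :
    ∑ m ∈ Finset.range (n+1), (bcount k N m : ℝ) * z^m / m.factorial ≤
      (∑ j ∈ Finset.range k, z^j / j.factorial)^N := by
  induction N with
  | zero =>
    have h0 : bcount k 0 0 ≤ 1 := by
      unfold bcount
      exact (Finset.card_filter_le _ _).trans (by simp)
    rw [Finset.sum_range_succ', Finset.sum_eq_zero]
    · simpa using h0
    · intro i _
      have : bcount k 0 (i+1) = 0 := by
        unfold bcount
        rw [Finset.card_eq_zero, Finset.filter_eq_empty_iff]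
        intro L; exact (L 0).elim0
      simp [this]
  | succ N ih =>
    have hS : 0 ≤ ∑ j ∈ Finset.range k, z^j / (j.factorial:ℝ) :=
      Finset.sum_nonneg fun _ _ => by positivity
    rw [pow_succ']
    refine le_trans ?_ (mul_le_mul_of_nonneg_left ih hS)
    rw [Finset.sum_mul_sum]
    have h1 : ∀ m, (bcount k (N+1) m : ℝ) * z^m / m.factorial ≤
        ∑ p ∈ Finset.HasAntidiagonal.antidiagonal m, if p.1 < k then
          z^p.1/p.1.factorial * ((bcount k N p.2 : ℝ) * z^p.2 / p.2.factorial) else 0 := by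
      intro m
      rw [Finset.Nat.sum_antidiagonal_eq_sum_range_succ_mk]
      have := bcount_rec k N m
      have h' : (bcount k (N+1) m : ℝ) ≤ ∑ j ∈ Finset.range (m+1), (m.choose j : ℝ) * (if j < k then (bcount k N (m - j) : ℝ) else 0) := by
        exact_mod_cast this
      calc _ ≤ (∑ j ∈ Finset.range (m+1), (m.choose j : ℝ) * (if j < k then (bcount k N (m - j) : ℝ) else 0)) * z^m / m.factorial := by gcongr
        _ = _ := by
          rw [Finset.sum_mul, Finset.sum_div]
          refine Finset.sum_congr rfl fun j hj => ?_
          have hj : j ≤ m := by simpa [Nat.lt_succ_iff] using hj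
          split_ifs
          · rw [Nat.cast_choose ℝ hj]
            have : z^m = z^j * z^(m-j) := by rw [← pow_add]; congr; omega
            rw [this]
            have := Nat.factorial_pos m
            field_simp
          · simp
    refine (Finset.sum_le_sum fun m _ => h1 m).trans ?_
    rw [Finset.sum_sigma', ← Finset.sum_product', ← Finset.sum_filter]
    refine le_trans (le_of_eq ?_) (Finset.sum_le_sum_of_subset_of_nonneg
      (s := ((Finset.range (n+1)).sigma fun m => Finset.HasAntidiagonal.antidiagonal m).filter (fun p => p.2.1 < k) |>.image fun p => p.2) ?_ ?_)
    · rw [Finset.sum_image]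
      rintro ⟨a, b⟩ h ⟨c, d⟩ h' hh
      simp at h h' hh
      subst hh
      obtain ⟨⟨_, rfl⟩, _⟩ := h
      obtain ⟨⟨_, rfl⟩, _⟩ := h'
      rfl
    · rintro ⟨a, b⟩ h
      simp at h ⊢
      omega
    · intros; positivity

theorem poisson_half (n : ℕ) :
    Real.exp (n/2) / 2 ≤ ∑ m ∈ Finset.range (n+1), ((n:ℝ)/2)^m / m.factorial := by
  set l : ℝ := (n:ℝ)/2 with hl
  have hl0 : 0 ≤ l := by positivity
  have hs := NormedSpace.expSeries_div_summable (𝔸 := ℝ) l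
  have hE : Real.exp l = ∑' m : ℕ, l^m / m.factorial := by
    rw [Real.exp_eq_exp_ℝ, NormedSpace.exp_eq_tsum_div]
  have h1 := hs.sum_add_tsum_nat_add (n+1)
  have h2 := hs.sum_add_tsum_nat_add n
  have h3 : ∑' i, l^(i+(n+1)) / ((i+(n+1)).factorial : ℝ) ≤ ∑' i, (1/2) * (l^(i+n) / ((i+n).factorial:ℝ)) := by
    refine Summable.tsum_le_tsum ?_ ((summable_nat_add_iff (n+1)).2 hs) (((summable_nat_add_iff n).2 hs).mul_left _)
    intro i
    rw [← add_assoc, pow_succ, Nat.factorial_succ]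
    push_cast
    rw [mul_comm ((i:ℝ)+n+1), ← div_mul_div_comm, mul_comm (1/2:ℝ)]
    refine mul_le_mul_of_nonneg_left ?_ (by positivity)
    rw [div_le_iff₀ (by positivity), hl]
    have : (0:ℝ) ≤ i := by positivity
    linarith
  rw [tsum_mul_left] at h3
  have h4 : 0 ≤ ∑ i ∈ Finset.range n, l^i / (i.factorial:ℝ) := Finset.sum_nonneg fun _ _ => by positivity
  linarith

theorem bcount_bound (k N n : ℕ) (hn : 0 < n) (hN : n ≤ N) :
    (bcount k N n : ℝ) / N^n ≤ 2 * Real.exp (-(N * (Real.exp (-1) * ((n:ℝ)/(2*N))^k / k.factorial))) := by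
  have hNp : (0:ℝ) < N := by exact_mod_cast lt_of_lt_of_le hn hN
  set z : ℝ := (n:ℝ)/(2*N) with hz
  have hz0 : 0 ≤ z := by positivity
  have hz1 : z ≤ 1 := by
    rw [hz, div_le_one (by positivity)]
    have : (n:ℝ) ≤ N := by exact_mod_cast hN
    linarith
  have hNz : N * z = (n:ℝ)/2 := by rw [hz]; field_simp
  set f := (bcount k N n : ℝ) / N^n with hf
  have hf0 : 0 ≤ f := by positivity
  have h1 : f * ∑ m ∈ Finset.range (n+1), ((n:ℝ)/2)^m / m.factorial ≤
      ∑ m ∈ Finset.range (n+1), (bcount k N m : ℝ) * z^m / m.factorial := by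
    rw [Finset.mul_sum]
    refine Finset.sum_le_sum fun m hm => ?_
    have hm : m ≤ n := by simpa [Nat.lt_succ_iff] using hm
    obtain ⟨d, rfl⟩ := Nat.exists_eq_add_of_le hm
    have h : (bcount k N (m+d) : ℝ) ≤ N^d * bcount k N m := by exact_mod_cast bcount_mono k N m d
    rw [← hNz, ← mul_div_assoc]
    refine div_le_div_of_nonneg_right ?_ (by positivity)
    rw [mul_pow, ← mul_assoc]
    refine mul_le_mul_of_nonneg_right ?_ (by positivity)
    rw [hf, div_mul_eq_mul_div, div_le_iff₀ (by positivity), pow_add]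
    calc _ ≤ (N^d * bcount k N m) * (N:ℝ)^m := by gcongr
      _ = _ := by ring
  have h2 := h1.trans (bcount_gf k N n z hz0)
  have h3 := mul_le_mul_of_nonneg_left (poisson_half n) hf0
  have h4 : ∑ j ∈ Finset.range k, z^j / (j.factorial:ℝ) ≤ Real.exp (z - Real.exp (-1) * z^k / k.factorial) := by
    have := Real.sum_le_exp_of_nonneg hz0 (k+1)
    rw [Finset.sum_range_succ] at this
    have h5 := Real.add_one_le_exp (-(Real.exp (-1) * z^k / k.factorial))
    rw [sub_eq_add_neg, Real.exp_add]
    have h6 := mul_le_mul_of_nonneg_left h5 (Real.exp_pos z).le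
    have h7 : Real.exp z * (Real.exp (-1) * z^k / k.factorial) ≤ z^k / k.factorial := by
      rw [mul_div_assoc, ← mul_assoc, ← Real.exp_add]
      refine mul_le_of_le_one_left (by positivity) ?_
      rw [Real.exp_le_one_iff]; linarith
    linarith
  have h5 : (∑ j ∈ Finset.range k, z^j / (j.factorial:ℝ))^N ≤ Real.exp ((n:ℝ)/2) * Real.exp (-(N * (Real.exp (-1) * z^k / k.factorial))) := by
    refine (pow_le_pow_left₀ (Finset.sum_nonneg fun _ _ => by positivity) h4 N).trans (le_of_eq ?_)
    rw [← Real.exp_nat_mul, ← Real.exp_add, mul_sub, hNz]; rfl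
  have h6 := h3.trans (h2.trans h5)
  have h7 := Real.exp_pos ((n:ℝ)/2)
  have : Real.exp ((n:ℝ)/2) * f ≤ Real.exp ((n:ℝ)/2) * (2 * Real.exp (-(N * (Real.exp (-1) * z^k / k.factorial)))) := by linarith
  exact le_of_mul_le_mul_left this h7

theorem volume_box (a b : Fin 2 → ℝ) :
    volume {x : EuclideanSpace ℝ (Fin 2) | ∀ i, x i ∈ Set.Icc (a i) (b i)} =
      ENNReal.ofReal (b 0 - a 0) * ENNReal.ofReal (b 1 - a 1) := by
  have h : {x : EuclideanSpace ℝ (Fin 2) | ∀ i, x i ∈ Set.Icc (a i) (b i)} =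
      (@WithLp.ofLp 2 (Fin 2 → ℝ)) ⁻¹' (Set.Icc a b) := by
    ext x
    simp only [Set.mem_ofPred_eq, Set.mem_preimage, Set.mem_Icc, Pi.le_def]
    exact forall_and
  rw [h, (PiLp.volume_preserving_ofLp (Fin 2)).measure_preimage measurableSet_Icc.nullMeasurableSet,
    Real.volume_Icc_pi]
  simp

theorem volume_unitSquare : volume unitSquare = 1 := by
  have := volume_box 0 1
  simpa [unitSquare] using this

instance sq_prob : IsProbabilityMeasure (volume.restrict unitSquare) :=
  ⟨by simp [volume_unitSquare]⟩

instance sqMeasure_prob (n : ℕ) : IsProbabilityMeasure (sqMeasure n) := by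
  unfold sqMeasure; infer_instance

def gcell (m : ℕ) (c : Fin (m^2)) : Set (EuclideanSpace ℝ (Fin 2)) :=
  {x | ∀ i, x i ∈ Set.Icc (((finFunctionFinEquiv.symm c : Fin 2 → Fin m) i : ℝ) / m)
    ((((finFunctionFinEquiv.symm c : Fin 2 → Fin m) i : ℝ) + 1) / m)}

theorem vol_gcell (m : ℕ) (c : Fin (m^2)) :
    volume (gcell m c) = ENNReal.ofReal (1 / ((m^2 : ℕ) : ℝ)) := by
  unfold gcell
  rw [volume_box, ← ENNReal.ofReal_mul (by rw [← sub_div]; simp)]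
  congr 1
  rw [← sub_div, ← sub_div]
  push_cast
  simp only [add_sub_cancel_left]
  rw [div_mul_div_comm]; ring

theorem exists_gcell (m : ℕ) (hm : 0 < m) (x : EuclideanSpace ℝ (Fin 2)) (hx : x ∈ unitSquare) :
    ∃ c, x ∈ gcell m c := by
  have hm' : (0:ℝ) < m := by exact_mod_cast hm
  have h : ∀ i, ∃ j : Fin m, x i ∈ Set.Icc ((j:ℝ)/m) (((j:ℝ)+1)/m) := by
    intro i
    obtain ⟨h0, h1⟩ := hx i
    by_cases hlt : x i < 1
    · have hp : 0 ≤ x i * m := by positivity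
      refine ⟨⟨⌊x i * m⌋₊, ?_⟩, ?_, ?_⟩
      · rw [Nat.floor_lt hp]; nlinarith
      · rw [div_le_iff₀ hm']; exact Nat.floor_le hp
      · rw [le_div_iff₀ hm']; exact (Nat.lt_floor_add_one _).le
    · have h1 : x i = 1 := le_antisymm h1 (not_lt.1 hlt)
      refine ⟨⟨m-1, by omega⟩, ?_, ?_⟩
      · rw [div_le_iff₀ hm', h1, one_mul]; simp
      · rw [le_div_iff₀ hm', h1, one_mul, Nat.cast_sub hm]; simp
  choose j hj using h
  exact ⟨finFunctionFinEquiv j, by simpa [gcell] using hj⟩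

theorem gcell_dist (m : ℕ) (hm : 0 < m) (c : Fin (m^2)) (x y : EuclideanSpace ℝ (Fin 2))
    (hx : x ∈ gcell m c) (hy : y ∈ gcell m c) : dist x y ≤ 2 / m := by
  have hm' : (0:ℝ) < m := by exact_mod_cast hm
  have h : ∀ i, (x i - y i)^2 ≤ (1/(m:ℝ))^2 := by
    intro i
    obtain ⟨a1, a2⟩ := hx i
    obtain ⟨b1, b2⟩ := hy i
    rw [add_div] at a2 b2
    apply sq_le_sq'  <;> linarith
  rw [EuclideanSpace.dist_eq]
  apply Real.sqrt_le_iff.2 ⟨by positivity, ?_⟩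
  simp only [Fin.sum_univ_two, Real.dist_eq, sq_abs]
  have h0 := h 0
  have h1 := h 1
  have : (2/(m:ℝ))^2 = 4 * (1/(m:ℝ))^2 := by ring
  have := sq_nonneg (1/(m:ℝ))
  linarith

theorem bad_bound (k n m : ℕ) (r : ℝ) (hm : 0 < m) (hr : 2 / (m:ℝ) ≤ r) :
    sqMeasure n {x | ∃ S : Finset (Fin n), (geomGraph n r x).IsNClique k S}ᶜ ≤
      ENNReal.ofReal ((bcount k (m^2) n : ℝ) / ((m^2 : ℕ) : ℝ)^n) := by
  classical
  set G := (Finset.univ.filter fun L : Fin n → Fin (m^2) =>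
    ∀ c, (Finset.univ.filter fun i => L i = c).card < k) with hG
  have hae : ∀ᵐ x ∂(sqMeasure n), ∀ i, x i ∈ unitSquare := by
    rw [eventually_all]
    intro i
    have hms : MeasurableSet unitSquare := by
      unfold unitSquare
      simp only [Set.ofPred_forall]
      refine MeasurableSet.iInter fun i => ?_
      exact measurableSet_Icc.preimage (by fun_prop)
    have h1 : ∀ᵐ y ∂(volume.restrict unitSquare), y ∈ unitSquare := ae_restrict_mem hms
    exact (Measure.tendsto_eval_ae_ae (μ := fun _ : Fin n => volume.restrict unitSquare) (i := i)).eventually h1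
  have hsub : {x | ∃ S : Finset (Fin n), (geomGraph n r x).IsNClique k S}ᶜ ≤ᵐ[sqMeasure n]
      ⋃ L ∈ G, Set.pi Set.univ (fun i => gcell m (L i)) := by
    filter_upwards [hae] with x hx hbad
    choose L hL using fun i => exists_gcell m hm (x i) (hx i)
    refine Set.mem_iUnion₂.2 ⟨L, ?_, fun i _ => hL i⟩
    rw [hG, Finset.mem_filter]
    refine ⟨Finset.mem_univ _, fun c => ?_⟩
    by_contra hc
    push Not at hc
    obtain ⟨S, hS, hScard⟩ := Finset.exists_subset_card_eq hc
    apply hbad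
    refine ⟨S, ⟨?_, hScard⟩⟩
    intro i hi j hj hij
    refine ⟨hij, (gcell_dist m hm c _ _ ?_ ?_).trans hr⟩
    · have := hS hi
      simp only [Finset.mem_filter, Finset.mem_univ, true_and] at this
      exact this ▸ hL i
    · have := hS hj
      simp only [Finset.mem_filter, Finset.mem_univ, true_and] at this
      exact this ▸ hL j
  refine (measure_mono_ae hsub).trans ((measure_biUnion_finset_le _ _).trans ?_)
  have : ∀ L ∈ G, sqMeasure n (Set.pi Set.univ (fun i => gcell m (L i))) ≤
      ENNReal.ofReal ((1 / ((m^2 : ℕ) : ℝ))^n) := by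
    intro L _
    unfold sqMeasure
    rw [Measure.pi_pi, ENNReal.ofReal_pow (by positivity)]
    refine (Finset.prod_le_prod' (g := fun _ => ENNReal.ofReal (1 / ((m^2 : ℕ) : ℝ))) ?_).trans (by simp)
    intro i _
    rw [← vol_gcell m (L i)]
    exact Measure.restrict_apply_le _ _
  refine (Finset.sum_le_sum this).trans (le_of_eq ?_)
  rw [Finset.sum_const, nsmul_eq_mul, ← ENNReal.ofReal_natCast, ← ENNReal.ofReal_mul (by positivity)]
  congr 1
  have : G.card = bcount k (m^2) n := rfl
  rw [this, one_div, inv_pow]; rfl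

theorem expo_bound (k n : ℕ) (hk : 2 ≤ k) (hn : 0 < n) (r : ℝ) (hr : 0 < r) :
    ∃ m : ℕ, 0 < m ∧ 2 / (m:ℝ) ≤ r ∧ n ≤ m^2 ∧
      min ((r * (n : ℝ) ^ ((k : ℝ) / (2 * (k : ℝ) - 2)))^(2*(k-1))) (n:ℝ) / 16^(k-1) * (Real.exp (-1) / (2^k * k.factorial)) ≤
      ((m^2 : ℕ) : ℝ) * (Real.exp (-1) * ((n:ℝ)/(2*((m^2 : ℕ) : ℝ)))^k / k.factorial) := by
  have hn1 : (1:ℝ) ≤ n := by exact_mod_cast hn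
  have hn0 : (0:ℝ) < n := by linarith
  set M : ℝ := max (2/r) (Real.sqrt n) with hM
  have hM1 : 1 ≤ M := le_max_of_le_right (Real.one_le_sqrt.2 hn1)
  set m := ⌈M⌉₊ with hm
  have hmM : M ≤ m := Nat.le_ceil M
  have hmM2 : (m:ℝ) ≤ 2 * M := by
    have := Nat.ceil_lt_add_one (a := M) (by linarith)
    linarith
  have hm0 : (0:ℝ) < m := by linarith
  refine ⟨m, by exact_mod_cast hm0, ?_, ?_, ?_⟩
  · rw [div_le_iff₀ hm0]
    have h : 2/r ≤ m := (le_max_left _ _).trans hmM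
    rw [div_le_iff₀ hr] at h
    linarith
  · have h : Real.sqrt n ≤ m := (le_max_right _ _).trans hmM
    rw [Real.sqrt_le_left hm0.le] at h
    exact_mod_cast h
  · obtain ⟨p, rfl⟩ : ∃ p, k = p + 1 := ⟨k-1, by omega⟩
    have hp : 1 ≤ p := by omega
    have hp0 : (0:ℝ) < p := by exact_mod_cast hp
    simp only [Nat.add_sub_cancel]
    push_cast
    have hw : (r * (n : ℝ) ^ (((p:ℝ)+1) / (2 * ((p:ℝ)+1) - 2)))^(2*p) = (r^2)^p * (n:ℝ)^(p+1) := by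
      rw [mul_pow, ← pow_mul, ← Real.rpow_natCast ((n:ℝ) ^ _), ← Real.rpow_mul hn0.le, ← Real.rpow_natCast (n:ℝ) (p+1)]
      congr 2
      push_cast
      have : 2 * ((p:ℝ)+1) - 2 = 2 * p := by ring
      rw [this]
      field_simp
    rw [hw]
    have hrhs : (m:ℝ)^2 * (Real.exp (-1) * ((n:ℝ)/(2*(m:ℝ)^2))^(p+1) / (p+1).factorial) =
        (n:ℝ)^(p+1) / ((m:ℝ)^2)^p * (Real.exp (-1) / (2^(p+1) * (p+1).factorial)) := by
      rw [div_pow, mul_pow, pow_succ ((m:ℝ)^2)]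
      field_simp
    rw [hrhs]
    refine mul_le_mul_of_nonneg_right ?_ (by positivity)
    have hmm : (m:ℝ)^2 ≤ 4 * M^2 := by nlinarith
    rw [div_le_div_iff₀ (by positivity) (by positivity)]
    rcases le_total (2/r) (Real.sqrt n) with h | h
    · have hMe : M^2 = n := by rw [hM, max_eq_right h, Real.sq_sqrt hn0.le]
      rw [hMe] at hmm
      calc _ ≤ (n:ℝ) * (16 * n)^p := by
            gcongr
            · exact min_le_right _ _
            · linarith
        _ = _ := by rw [mul_pow]; ring
    · have hMe : M^2 = 4 / r^2 := by rw [hM, max_eq_left h, div_pow]; norm_num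
      rw [hMe] at hmm
      calc _ ≤ ((r^2)^p * (n:ℝ)^(p+1)) * (16 / r^2)^p := by
            gcongr
            · exact min_le_left _ _
            · refine hmm.trans (le_of_eq (by ring))
        _ = _ := by rw [div_pow]; field_simp

theorem clique_supercritical (k : ℕ) (hk : 2 ≤ k) (r : ℕ → ℝ)
    (hrpos : ∀ n, 0 < r n)
    (hr : Tendsto (fun n : ℕ => r n * (n : ℝ) ^ ((k : ℝ) / (2 * (k : ℝ) - 2)))
      atTop atTop) :
    Tendsto
      (fun n : ℕ => sqMeasure n
        {x | ∃ S : Finset (Fin n), (geomGraph n (r n) x).IsNClique k S})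
      atTop (nhds 1) := by
  
  set C : ℝ := Real.exp (-1) / (2^k * k.factorial) with hC
  have hC0 : 0 < C := by positivity
  set q : ℕ → ℝ := fun n => min ((r n * (n : ℝ) ^ ((k : ℝ) / (2 * (k : ℝ) - 2)))^(2*(k-1))) (n:ℝ) with hq
  have hqt : Tendsto q atTop atTop := by
    have h1 : Tendsto (fun n : ℕ => (r n * (n : ℝ) ^ ((k : ℝ) / (2 * (k : ℝ) - 2)))^(2*(k-1))) atTop atTop :=
      (tendsto_pow_atTop (by omega)).comp hr
    rw [tendsto_atTop]
    intro B
    filter_upwards [h1.eventually_ge_atTop B, tendsto_natCast_atTop_atTop.eventually_ge_atTop B] with n h h'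
    exact le_min h h'
  have hlim : Tendsto (fun n => 1 - ENNReal.ofReal (2 * Real.exp (-(q n / 16^(k-1) * C)))) atTop (nhds 1) := by
    have h1 : Tendsto (fun n => 2 * Real.exp (-(q n / 16^(k-1) * C))) atTop (nhds (2 * 0)) := by
      refine Tendsto.const_mul _ (Real.tendsto_exp_neg_atTop_nhds_zero.comp ?_)
      exact (hqt.atTop_div_const (by positivity)).atTop_mul_const hC0
    have h2 := ENNReal.tendsto_ofReal h1
    have h3 := ENNReal.Tendsto.sub (tendsto_const_nhds (x := (1:ENNReal))) h2 (Or.inl ENNReal.one_ne_top)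
    simpa using h3
  refine tendsto_of_tendsto_of_tendsto_of_le_of_le' hlim tendsto_const_nhds ?_ (Eventually.of_forall fun n => prob_le_one)
  filter_upwards [eventually_gt_atTop 0] with n hn
  obtain ⟨m, hm, hmr, hnm, hb⟩ := expo_bound k n hk hn (r n) (hrpos n)
  have h1 := bad_bound k n m (r n) hm hmr
  have h2 := bcount_bound k (m^2) n hn hnm
  have h3 : (bcount k (m^2) n : ℝ) / ((m^2 : ℕ) : ℝ)^n ≤ 2 * Real.exp (-(q n / 16^(k-1) * C)) := by
    refine h2.trans ?_
    gcongr
  have h4 := h1.trans (ENNReal.ofReal_le_ofReal h3)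
  have h5 : 1 ≤ sqMeasure n {x | ∃ S : Finset (Fin n), (geomGraph n (r n) x).IsNClique k S} +
      sqMeasure n {x | ∃ S : Finset (Fin n), (geomGraph n (r n) x).IsNClique k S}ᶜ := by
    rw [← measure_univ (μ := sqMeasure n), ← Set.union_compl_self {x | ∃ S : Finset (Fin n), (geomGraph n (r n) x).IsNClique k S}]
    exact measure_union_le _ _
  exact tsub_le_iff_right.2 (h5.trans (by gcongr))
end
end

section
/- Let r : ℕ → ℝ be a positive function. If n·r(n) → 0 as n → ∞, then the probability that the random geometric graph G(n, r(n)) has at least one edge tends to 0; if n·r(n) → ∞ as n → ∞, then this probability tends to 1. (That is, n^{−1} is a distance threshold for G(n,r) to have an edge.) -/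
open MeasureTheory Filter

noncomputable section

lemma vol_box (a b : Fin 2 → ℝ) :
    volume {x : EuclideanSpace ℝ (Fin 2) | ∀ i, x i ∈ Set.Icc (a i) (b i)}
      = ∏ i, ENNReal.ofReal (b i - a i) := by
  have h := (PiLp.volume_preserving_ofLp (Fin 2)).measure_preimage
    (s := Set.pi Set.univ (fun i => Set.Icc (a i) (b i)))
    (MeasurableSet.univ_pi (fun i => measurableSet_Icc)).nullMeasurableSet
  rw [Set.pi_univ_Icc, Real.volume_Icc_pi] at h
  rw [← h]
  congr 1
  ext x
  simp [Pi.le_def, forall_and]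

lemma meas_sq : MeasurableSet unitSquare := by
  have : unitSquare = ⋂ i, {x : EuclideanSpace ℝ (Fin 2) | x i ∈ Set.Icc (0:ℝ) 1} := by
    ext x; simp [unitSquare]
  rw [this]
  refine MeasurableSet.iInter fun i => ?_
  have hm : Measurable (fun x : EuclideanSpace ℝ (Fin 2) => x i) := by fun_prop
  exact hm measurableSet_Icc

instance prob_sq : IsProbabilityMeasure (volume.restrict unitSquare) := by
  constructor
  rw [Measure.restrict_apply_univ]
  have := vol_box (fun _ => 0) (fun _ => 1)
  simpa [unitSquare] using this

instance prob_pi (n : ℕ) : IsProbabilityMeasure (sqMeasure n) := by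
  unfold sqMeasure; infer_instance

lemma pair_bound (n : ℕ) (i j : Fin n) (hij : i ≠ j) (r : ℝ) (hr : 0 ≤ r) :
    sqMeasure n {x | dist (x i) (x j) ≤ r} ≤
      ENNReal.ofReal (r ^ 2) * volume (Metric.ball (0 : EuclideanSpace ℝ (Fin 2)) 1) := by
  have hind := (ProbabilityTheory.iIndepFun_pi (μ := fun _ : Fin n => volume.restrict unitSquare)
    (X := fun _ x => x) (fun _ => aemeasurable_id)).indepFun hij
  rw [ProbabilityTheory.indepFun_iff_map_prod_eq_prod_map_map (measurable_pi_apply i).aemeasurable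
    (measurable_pi_apply j).aemeasurable] at hind
  have e : ∀ k : Fin n, Measure.map (fun ω : Fin n → EuclideanSpace ℝ (Fin 2) => ω k)
      (Measure.pi fun _ => volume.restrict unitSquare) = volume.restrict unitSquare :=
    fun k => (measurePreserving_eval (fun _ : Fin n => volume.restrict unitSquare) k).map_eq
  rw [e, e] at hind
  have hS : MeasurableSet {p : EuclideanSpace ℝ (Fin 2) × EuclideanSpace ℝ (Fin 2) |
      dist p.1 p.2 ≤ r} := measurableSet_le (by fun_prop) (by fun_prop)
  have h1 : sqMeasure n {x | dist (x i) (x j) ≤ r} =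
      ((volume.restrict unitSquare).prod (volume.restrict unitSquare))
        {p : EuclideanSpace ℝ (Fin 2) × EuclideanSpace ℝ (Fin 2) | dist p.1 p.2 ≤ r} := by
    rw [← hind, Measure.map_apply (by fun_prop) hS]; rfl
  rw [h1, Measure.prod_apply hS]
  calc _ ≤ ∫⁻ x, ENNReal.ofReal (r ^ 2) * volume (Metric.ball (0 : EuclideanSpace ℝ (Fin 2)) 1)
        ∂(volume.restrict unitSquare) := by
        refine lintegral_mono fun x => ?_
        refine (Measure.restrict_apply_le _ _).trans ?_
        have := Measure.addHaar_closedBall (volume : Measure (EuclideanSpace ℝ (Fin 2))) x hr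
        rw [finrank_euclideanSpace_fin] at this
        rw [← this]
        refine measure_mono fun y hy => ?_
        simp only [Set.mem_preimage, Set.mem_ofPred_eq] at hy
        rw [Metric.mem_closedBall, dist_comm]; exact hy
    _ = _ := by simp

lemma upper (n : ℕ) (r : ℝ) (hr : 0 ≤ r) :
    sqMeasure n {x | ∃ i j : Fin n, (geomGraph n r x).Adj i j} ≤
      ENNReal.ofReal ((n * r) ^ 2) *
        volume (Metric.ball (0 : EuclideanSpace ℝ (Fin 2)) 1) := by
  set C := volume (Metric.ball (0 : EuclideanSpace ℝ (Fin 2)) 1)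
  have hs : {x | ∃ i j : Fin n, (geomGraph n r x).Adj i j} ⊆
      ⋃ p : Fin n × Fin n, {x | p.1 ≠ p.2 ∧ dist (x p.1) (x p.2) ≤ r} := by
    rintro x ⟨i, j, h⟩
    exact Set.mem_iUnion.2 ⟨(i, j), h⟩
  refine (measure_mono hs).trans ((measure_iUnion_fintype_le _ _).trans ?_)
  calc _ ≤ ∑ p : Fin n × Fin n, ENNReal.ofReal (r ^ 2) * C := by
        refine Finset.sum_le_sum fun p _ => ?_
        by_cases h : p.1 = p.2
        · simp [h]
        · exact (measure_mono (fun x hx => hx.2)).trans (pair_bound n p.1 p.2 h r hr)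
    _ = _ := by
        rw [Finset.sum_const, Finset.card_univ, Fintype.card_prod, Fintype.card_fin, nsmul_eq_mul,
          ← mul_assoc, mul_pow, ENNReal.ofReal_mul (by positivity)]
        congr 2
        rw [← ENNReal.ofReal_natCast]
        push_cast
        rw [sq]

lemma desc_bound (M n : ℕ) (hM : 0 < M) :
    (M.descFactorial n : ℝ) * ((M : ℝ)⁻¹) ^ n ≤ Real.exp (-((n : ℝ) * (n - 1) / 2) / M) := by
  have hM' : (0:ℝ) < M := by exact_mod_cast hM
  induction n with
  | zero => simp
  | succ n ih =>
    rw [Nat.descFactorial_succ, pow_succ]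
    have h1 : ((M - n : ℕ) : ℝ) * (M : ℝ)⁻¹ ≤ Real.exp (-(n : ℝ) / M) := by
      rcases le_total n M with h | h
      · rw [Nat.cast_sub h]
        have := Real.add_one_le_exp (-(n : ℝ) / M)
        refine le_trans (le_of_eq ?_) this
        field_simp; ring
      · rw [Nat.sub_eq_zero_of_le h]; simp; positivity
    calc _ = (((M - n : ℕ) : ℝ) * (M : ℝ)⁻¹) * ((M.descFactorial n : ℝ) * ((M : ℝ)⁻¹) ^ n) := by
          push_cast; ring
      _ ≤ Real.exp (-(n : ℝ) / M) * Real.exp (-((n : ℝ) * (n - 1) / 2) / M) := by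
          gcongr
      _ = _ := by
          rw [← Real.exp_add]; congr 1; push_cast; field_simp; ring

def cellBox (K : ℕ) (c : Fin 2 → Fin K) : Set (EuclideanSpace ℝ (Fin 2)) :=
  {x | ∀ i, x i ∈ Set.Icc ((c i : ℕ) / (K : ℝ)) (((c i : ℕ) + 1) / (K : ℝ))}

lemma cell_cover1 (K : ℕ) (hK : 0 < K) (t : ℝ) (ht : t ∈ Set.Icc (0:ℝ) 1) :
    ∃ c : Fin K, t ∈ Set.Icc ((c : ℕ) / (K : ℝ)) (((c : ℕ) + 1) / (K : ℝ)) := by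
  have hK' : (0:ℝ) < K := by exact_mod_cast hK
  obtain ⟨h0, h1⟩ := ht
  by_cases h : t = 1
  · refine ⟨⟨K - 1, by omega⟩, ?_⟩
    have : ((K - 1 : ℕ) : ℝ) = K - 1 := by rw [Nat.cast_sub hK]; simp
    simp only [this, Set.mem_Icc, div_le_iff₀ hK', le_div_iff₀ hK', h]
    constructor <;> linarith
  · have hlt : t < 1 := lt_of_le_of_ne h1 h
    have hp : 0 ≤ t * K := by positivity
    refine ⟨⟨⌊t * K⌋₊, (Nat.floor_lt hp).2 (by nlinarith)⟩, ?_⟩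
    simp only [Set.mem_Icc, div_le_iff₀ hK', le_div_iff₀ hK']
    exact ⟨Nat.floor_le hp, (Nat.lt_floor_add_one _).le⟩

lemma cell_cover (K : ℕ) (hK : 0 < K) (x : EuclideanSpace ℝ (Fin 2)) (hx : x ∈ unitSquare) :
    ∃ c, x ∈ cellBox K c := by
  choose c hc using fun i => cell_cover1 K hK (x i) (hx i)
  exact ⟨c, hc⟩

lemma cell_dist (K : ℕ) (hK : 0 < K) (c) (x y : EuclideanSpace ℝ (Fin 2))
    (hx : x ∈ cellBox K c) (hy : y ∈ cellBox K c) : dist x y ≤ 2 / K := by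
  have hK' : (0:ℝ) < K := by exact_mod_cast hK
  have h : ∀ i, dist (x i) (y i) ^ 2 ≤ (1 / (K:ℝ)) ^ 2 := by
    intro i
    have := Real.dist_le_of_mem_Icc (hx i) (hy i)
    have e : ((c i : ℕ) + 1) / (K : ℝ) - (c i : ℕ) / (K : ℝ) = 1 / K := by ring
    rw [e] at this
    gcongr
  rw [EuclideanSpace.dist_eq]
  refine Real.sqrt_le_iff.2 ⟨by positivity, ?_⟩
  rw [Fin.sum_univ_two]
  have e : (2 / (K:ℝ)) ^ 2 = 4 * (1 / (K:ℝ)) ^ 2 := by ring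
  nlinarith [h 0, h 1, sq_nonneg (1 / (K:ℝ))]

lemma cell_vol (K : ℕ) (hK : 0 < K) (c) :
    volume.restrict unitSquare (cellBox K c) ≤ ENNReal.ofReal (((K ^ 2 : ℕ) : ℝ)⁻¹) := by
  refine (Measure.restrict_apply_le _ _).trans ?_
  unfold cellBox
  rw [vol_box, Fin.prod_univ_two, ← ENNReal.ofReal_mul]
  · apply ENNReal.ofReal_le_ofReal
    apply le_of_eq
    push_cast; ring
  · rw [← sub_div]; simp

lemma noedge (n K : ℕ) (hK : 0 < K) (r : ℝ) (hr : 2 / K ≤ r) :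
    sqMeasure n {x | ∃ i j : Fin n, (geomGraph n r x).Adj i j}ᶜ ≤
      ENNReal.ofReal (Real.exp (-((n : ℝ) * (n - 1) / 2) / ((K ^ 2 : ℕ) : ℝ))) := by
  have hae : ∀ᵐ x ∂(sqMeasure n), ∀ i, x i ∈ unitSquare := by
    rw [ae_all_iff]
    intro i
    exact (Measure.quasiMeasurePreserving_eval (fun _ : Fin n => volume.restrict unitSquare) i).ae
      (ae_restrict_mem meas_sq)
  have hs : {x | ∃ i j : Fin n, (geomGraph n r x).Adj i j}ᶜ ≤ᵐ[sqMeasure n]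
      ⋃ f : Fin n ↪ (Fin 2 → Fin K), Set.pi Set.univ (fun i => cellBox K (f i)) := by
    filter_upwards [hae] with x hx hno
    choose c hc using fun i => cell_cover K hK (x i) (hx i)
    refine Set.mem_iUnion.2 ⟨⟨c, fun i j hij => ?_⟩, fun i _ => hc i⟩
    by_contra hne
    refine hno ⟨i, j, hne, (cell_dist K hK (c i) _ _ (hc i) ?_).trans hr⟩
    rw [hij]; exact hc j
  refine (measure_mono_ae hs).trans ((measure_iUnion_fintype_le _ _).trans ?_)
  calc _ ≤ ∑ f : Fin n ↪ (Fin 2 → Fin K), ENNReal.ofReal ((((K ^ 2 : ℕ) : ℝ)⁻¹) ^ n) := by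
        refine Finset.sum_le_sum fun f _ => ?_
        rw [sqMeasure, Measure.pi_pi]
        refine (Finset.prod_le_pow_card _ _ _ (fun i _ => cell_vol K hK (f i))).trans ?_
        rw [ENNReal.ofReal_pow (by positivity)]; simp
    _ = ENNReal.ofReal (((K ^ 2).descFactorial n : ℝ) * (((K ^ 2 : ℕ) : ℝ)⁻¹) ^ n) := by
        rw [Finset.sum_const, Finset.card_univ, Fintype.card_embedding_eq]
        simp only [Fintype.card_fun, Fintype.card_fin]
        rw [nsmul_eq_mul, ENNReal.ofReal_mul (by positivity), ENNReal.ofReal_natCast]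
    _ ≤ _ := ENNReal.ofReal_le_ofReal (desc_bound _ _ (by positivity))

theorem edge_threshold (r : ℕ → ℝ) (hrpos : ∀ n, 0 < r n) :
    (Tendsto (fun n : ℕ => (n : ℝ) * r n) atTop (nhds 0) →
      Tendsto
        (fun n : ℕ => sqMeasure n {x | ∃ i j : Fin n, (geomGraph n (r n) x).Adj i j})
        atTop (nhds 0)) ∧
    (Tendsto (fun n : ℕ => (n : ℝ) * r n) atTop atTop →
      Tendsto
        (fun n : ℕ => sqMeasure n {x | ∃ i j : Fin n, (geomGraph n (r n) x).Adj i j})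
        atTop (nhds 1)) := by
  constructor
  · intro h
    have h2 : Tendsto (fun n : ℕ => ENNReal.ofReal (((n : ℝ) * r n) ^ 2) *
        volume (Metric.ball (0 : EuclideanSpace ℝ (Fin 2)) 1)) atTop (nhds 0) := by
      have h3 := ENNReal.tendsto_ofReal (h.pow 2)
      have h4 := ENNReal.Tendsto.mul_const
        (b := volume (Metric.ball (0 : EuclideanSpace ℝ (Fin 2)) 1)) h3
        (Or.inr measure_ball_lt_top.ne)
      simpa using h4
    exact tendsto_of_tendsto_of_tendsto_of_le_of_le tendsto_const_nhds h2
      (fun _ => zero_le) (fun n => upper n (r n) (hrpos n).le)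
  · intro h
    set K : ℕ → ℕ := fun n => ⌈2 / r n⌉₊ with hKdef
    have hK : ∀ n, 0 < K n := fun n => Nat.ceil_pos.2 (div_pos two_pos (hrpos n))
    have hKr : ∀ n, 2 / (K n : ℝ) ≤ r n := fun n => by
      have hk : (0:ℝ) < K n := by exact_mod_cast hK n
      have := Nat.le_ceil (2 / r n)
      rw [div_le_iff₀ (hrpos n)] at this
      rw [div_le_iff₀ hk, mul_comm]; exact this
    have hT : Tendsto (fun n : ℕ => ((n : ℝ) * (n - 1) / 2) / ((K n ^ 2 : ℕ) : ℝ)) atTop atTop := by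
      rw [tendsto_atTop]
      intro A
      set B := max A 1 with hB
      have hB1 : 1 ≤ B := le_max_right _ _
      have hBA : A ≤ B := le_max_left _ _
      filter_upwards [h.eventually_ge_atTop (8 * B), tendsto_natCast_atTop_atTop.eventually_ge_atTop (4 * B)]
        with n h1 h2
      have hk : (0:ℝ) < K n := by exact_mod_cast hK n
      have hr := hrpos n
      have hc : (K n : ℝ) ≤ 2 / r n + 1 := (Nat.ceil_lt_add_one (by positivity)).le
      have h3 : 2 * B * (2 / r n) ≤ n / 2 := by
        rw [mul_div_assoc', div_le_iff₀ hr]; linarith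
      have h4 : 2 * B * K n ≤ n := by nlinarith
      push_cast
      rw [le_div_iff₀ (by positivity)]
      have h5 : (2 * B * K n) ^ 2 ≤ (n : ℝ) ^ 2 := by gcongr
      have h6 : A * (K n : ℝ) ^ 2 ≤ B ^ 2 * (K n : ℝ) ^ 2 := by
        gcongr; nlinarith
      nlinarith
    have hE : Tendsto (fun n : ℕ => ENNReal.ofReal
        (Real.exp (-((n : ℝ) * (n - 1) / 2) / ((K n ^ 2 : ℕ) : ℝ)))) atTop (nhds 0) := by
      have := ENNReal.tendsto_ofReal (Real.tendsto_exp_neg_atTop_nhds_zero.comp hT)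
      simpa [Function.comp_def, neg_div] using this
    have hL : Tendsto (fun n : ℕ => 1 - ENNReal.ofReal
        (Real.exp (-((n : ℝ) * (n - 1) / 2) / ((K n ^ 2 : ℕ) : ℝ)))) atTop (nhds 1) := by
      have := ENNReal.Tendsto.sub (tendsto_const_nhds (x := (1 : ENNReal)) (f := atTop)) hE
        (Or.inl ENNReal.one_ne_top)
      simpa using this
    refine tendsto_of_tendsto_of_tendsto_of_le_of_le hL tendsto_const_nhds
      (fun n => ?_) (fun n => prob_le_one)
    rw [tsub_le_iff_right]
    calc (1 : ENNReal) = sqMeasure n Set.univ := measure_univ.symm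
      _ ≤ sqMeasure n {x | ∃ i j : Fin n, (geomGraph n (r n) x).Adj i j} +
          sqMeasure n {x | ∃ i j : Fin n, (geomGraph n (r n) x).Adj i j}ᶜ := by
          rw [← Set.union_compl_self {x | ∃ i j : Fin n, (geomGraph n (r n) x).Adj i j}]
          exact measure_union_le _ _
      _ ≤ _ := by gcongr; exact noedge n (K n) (hK n) (r n) (hKr n)
end
end

section
/- Let r : ℕ → ℝ be a positive function. If n^{3/4}·r(n) → 0 as n → ∞, then the probability that the random geometric graph G(n, r(n)) contains a triangle (three pairwise adjacent vertices) tends to 0; if n^{3/4}·r(n) → ∞ as n → ∞, then this probability tends to 1. (That is, n^{−3/4} is a distance threshold for G(n,r) to have a triangle.) -/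
open MeasureTheory Filter

noncomputable section

abbrev E2 := EuclideanSpace ℝ (Fin 2)

def qbox (a b : Fin 2 → ℝ) : Set E2 := WithLp.ofLp ⁻¹' (Set.univ.pi fun i => Set.Ico (a i) (b i))

lemma qbox_meas (a b : Fin 2 → ℝ) : MeasurableSet (qbox a b) :=
  (PiLp.volume_preserving_ofLp (Fin 2)).measurable
    (MeasurableSet.univ_pi fun _ => measurableSet_Ico)

lemma qbox_vol (a b : Fin 2 → ℝ) : volume (qbox a b) = ∏ i, ENNReal.ofReal (b i - a i) := by
  rw [qbox, (PiLp.volume_preserving_ofLp (Fin 2)).measure_preimage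
    (MeasurableSet.univ_pi fun _ => measurableSet_Ico).nullMeasurableSet, Real.volume_pi_Ico]

instance sqProb : IsProbabilityMeasure ((volume : Measure E2).restrict unitSquare) := by
  constructor
  have : unitSquare = WithLp.ofLp ⁻¹' (Set.univ.pi fun _ : Fin 2 => Set.Icc (0:ℝ) 1) := by
    ext x
    exact ⟨fun h i _ => h i, fun h i => h i trivial⟩
  rw [Measure.restrict_apply_univ, this, (PiLp.volume_preserving_ofLp (Fin 2)).measure_preimage
    (MeasurableSet.univ_pi fun _ => measurableSet_Icc).nullMeasurableSet, volume_pi_pi]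
  simp

instance sqProb' (n : ℕ) : IsProbabilityMeasure (sqMeasure n) := by
  unfold sqMeasure; infer_instance

lemma map_precomp {κ : Type*} [Fintype κ] {n : ℕ} (e : κ → Fin n) (he : e.Injective) :
    (sqMeasure n).map (fun x k => x (e k)) = Measure.pi fun _ : κ => volume.restrict unitSquare := by
  have h1 : ProbabilityTheory.iIndepFun (fun i (x : Fin n → E2) => x i) (sqMeasure n) :=
    ProbabilityTheory.iIndepFun_pi (μ := fun _ : Fin n => (volume : Measure E2).restrict unitSquare)
      (X := fun i x => x) (fun i => aemeasurable_id)
  have h2 := h1.precomp he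
  rw [ProbabilityTheory.iIndepFun_iff_map_fun_eq_pi_map
    (fun i => (measurable_pi_apply _).aemeasurable)] at h2
  rw [h2]
  congr 1
  ext1 k
  exact (measurePreserving_eval (fun _ : Fin n => (volume : Measure E2).restrict unitSquare) (e k)).map_eq

lemma triple_bound {n : ℕ} (r : ℝ) (e : Fin 3 → Fin n) (he : e.Injective) :
    sqMeasure n {x | dist (x (e 1)) (x (e 0)) ≤ r ∧ dist (x (e 2)) (x (e 0)) ≤ r} ≤
      (ENNReal.ofReal r ^ 2 * ENNReal.ofReal Real.pi)^2 := by
  have hA : MeasurableSet {p : E2 × (Fin 2 → E2) | ∀ k, dist (p.2 k) p.1 ≤ r} := by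
    apply IsClosed.measurableSet
    simp only [Set.ofPred_forall]
    exact isClosed_iInter fun k => isClosed_le (by fun_prop) (by fun_prop)
  have h2 := measurePreserving_piFinSuccAbove (fun _ : Fin 3 => (volume : Measure E2).restrict unitSquare) 0
  have h1 : MeasurePreserving (fun (x : Fin n → E2) (k : Fin 3) => x (e k)) (sqMeasure n)
      (Measure.pi fun _ : Fin 3 => volume.restrict unitSquare) :=
    ⟨by fun_prop, map_precomp e he⟩
  have h3 := (h2.comp h1).measure_preimage hA.nullMeasurableSet
  calc _ = _ := by
        congr 1
        ext x
        simp [Fin.forall_fin_two, MeasurableEquiv.piFinSuccAbove, Fin.insertNthEquiv]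
        exact Iff.rfl
    _ = _ := h3
    _ ≤ _ := by
        rw [Measure.prod_apply hA]
        calc _ ≤ ∫⁻ x : E2, (ENNReal.ofReal r ^ 2 * ENNReal.ofReal Real.pi)^2 ∂(volume.restrict unitSquare) := by
              apply lintegral_mono
              intro x
              have : (Prod.mk x ⁻¹' {p : E2 × (Fin 2 → E2) | ∀ k, dist (p.2 k) p.1 ≤ r}) =
                  Set.univ.pi fun _ => Metric.closedBall x r := by
                ext y; simp [Set.mem_pi]
              simp only [this]
              rw [Measure.pi_pi]
              rw [Finset.prod_const, Finset.card_univ, Fintype.card_fin]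
              gcongr
              exact (Measure.restrict_apply_le _ _).trans (EuclideanSpace.volume_closedBall_fin_two x r).le
          _ = _ := by simp

lemma upper_bound (n : ℕ) (r : ℝ) :
    sqMeasure n {x | ∃ S : Finset (Fin n), (geomGraph n r x).IsNClique 3 S} ≤
      (n:ENNReal)^3 * (ENNReal.ofReal r ^ 2 * ENNReal.ofReal Real.pi)^2 := by
  classical
  calc _ ≤ sqMeasure n (⋃ e : Fin 3 → Fin n, {x | e.Injective ∧ dist (x (e 1)) (x (e 0)) ≤ r ∧ dist (x (e 2)) (x (e 0)) ≤ r}) := by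
        apply measure_mono
        rintro x ⟨S, hS⟩
        obtain ⟨a, b, c, hab, hac, hbc, -⟩ := SimpleGraph.is3Clique_iff.1 hS
        refine Set.mem_iUnion.2 ⟨![a, b, c], ?_, ?_, ?_⟩
        · have := hab.1; have := hac.1; have := hbc.1
          intro i j
          fin_cases i <;> fin_cases j <;> simp_all [eq_comm]
        · simpa [dist_comm] using hab.2
        · simpa [dist_comm] using hac.2
    _ ≤ ∑ e : Fin 3 → Fin n, (ENNReal.ofReal r ^ 2 * ENNReal.ofReal Real.pi)^2 := by
        refine (measure_iUnion_fintype_le _ _).trans (Finset.sum_le_sum fun e _ => ?_)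
        by_cases he : e.Injective
        · simpa [he] using triple_bound r e he
        · simp [he]
    _ = _ := by simp

lemma part1 (r : ℕ → ℝ) (hr : ∀ n, 0 < r n)
    (h : Tendsto (fun n : ℕ => (n : ℝ) ^ ((3 : ℝ) / 4) * r n) atTop (nhds 0)) :
      Tendsto
        (fun n : ℕ => sqMeasure n
          {x | ∃ S : Finset (Fin n), (geomGraph n (r n) x).IsNClique 3 S})
        atTop (nhds 0) := by
  have h4 := ENNReal.tendsto_ofReal ((h.pow 4).mul_const (Real.pi ^ 2))
  simp only [ne_eq, OfNat.ofNat_ne_zero, not_false_eq_true, zero_pow, zero_mul, ENNReal.ofReal_zero] at h4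
  refine tendsto_of_tendsto_of_tendsto_of_le_of_le tendsto_const_nhds h4 (fun _ => zero_le) fun n => ?_
  refine (upper_bound n (r n)).trans (le_of_eq ?_)
  have h0 := (hr n).le
  rw [← ENNReal.ofReal_natCast, ← ENNReal.ofReal_pow (by positivity), ← ENNReal.ofReal_pow (by positivity),
    ← ENNReal.ofReal_mul (by positivity), ← ENNReal.ofReal_pow (by positivity), ← ENNReal.ofReal_mul (by positivity)]
  congr 1
  rw [mul_pow ((n:ℝ)^_), ← Real.rpow_natCast ((n:ℝ)^_), ← Real.rpow_mul (by positivity)]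
  norm_num
  ring

section Count
open Finset
lemma aux_prob {s : ℕ} {C : Type*} [Fintype C] [DecidableEq C] [Nonempty C] (i j : Fin s) (c c' : C) :
    (∑ f : Fin s → C, (if f i = c then (1:ℝ) else 0) * (if f j = c' then 1 else 0)) =
      (Fintype.card C : ℝ) ^ s * (if i = j then (if c = c' then 1 / (Fintype.card C : ℝ) else 0)
        else 1 / (Fintype.card C : ℝ)^2) := by
  have hM : (Fintype.card C : ℝ) ≠ 0 := by positivity
  have key : ∀ w : Fin s → C → ℝ, ∑ f : Fin s → C, ∏ k, w k (f k) = ∏ k, ∑ c, w k c := by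
    intro w
    rw [Finset.prod_univ_sum]; simp
  have h2 : ∀ f : Fin s → C, (if f i = c then (1:ℝ) else 0) * (if f j = c' then 1 else 0) =
     ∏ k, ((if k = i then (if f k = c then (1:ℝ) else 0) else 1) *
        (if k = j then (if f k = c' then (1:ℝ) else 0) else 1)) := by
    intro f
    rw [Finset.prod_mul_distrib, Finset.prod_ite_eq' , Finset.prod_ite_eq']; simp
  simp_rw [h2]
  rw [key (fun k a => ((if k = i then (if a = c then (1:ℝ) else 0) else 1) *
        (if k = j then (if a = c' then (1:ℝ) else 0) else 1)))]
  have h3 : ∀ k, ∑ a : C, ((if k = i then (if a = c then (1:ℝ) else 0) else 1) *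
        (if k = j then (if a = c' then (1:ℝ) else 0) else 1)) =
      (Fintype.card C : ℝ) * (if k = i then (if i = j then (if c = c' then 1 / (Fintype.card C : ℝ) else 0)
        else 1 / (Fintype.card C : ℝ)) else 1) *
        (if k = j then (if i = j then 1 else 1 / (Fintype.card C : ℝ)) else 1) := by
    intro k
    by_cases h1 : k = i
    · subst h1
      by_cases h2 : k = j
      · subst h2
        by_cases h4 : c = c' 
        · subst h4; simp [hM]
        · simp [h4, Ne.symm h4]
      · simp [h2, hM]
    · by_cases h2 : k = j
      · subst h2
        simp [h1, Ne.symm h1, hM]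
      · simp [h1, h2]
  simp_rw [h3]
  rw [Finset.prod_mul_distrib, Finset.prod_mul_distrib, Finset.prod_ite_eq' , Finset.prod_ite_eq']
  by_cases h : i = j
  · simp [h]
  · simp [h]; ring

lemma second_moment {s : ℕ} (hs : 0 < s) {C : Type*} [Fintype C] [DecidableEq C] [Nonempty C] :
    (Fintype.card C : ℝ) ^ (3 * s) / (1 + 3 / s + 3 * (Fintype.card C : ℝ) / s ^ 2
       + (Fintype.card C : ℝ)^2 / s^3) ≤
    ((univ.filter (fun Φ : Fin 3 → Fin s → C => ∃ c, ∀ k, ∃ i, Φ k i = c)).card : ℝ) := by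
  set M : ℝ := (Fintype.card C : ℝ) with hMdef
  have hM : 0 < M := by positivity
  have hs' : (0:ℝ) < s := by positivity
  set B := univ.filter (fun Φ : Fin 3 → Fin s → C => ∃ c, ∀ k, ∃ i, Φ k i = c) with hB
  let α : (Fin s → C) → C → ℝ := fun f c => ∑ i, if f i = c then 1 else 0
  let N : (Fin 3 → Fin s → C) → ℝ := fun Φ => ∑ c, ∏ k, α (Φ k) c
  have g2 : ∀ c c', ∑ f, α f c * α f c' =
      M ^ s * (s * (s - 1) / M^2 + if c = c' then s / M else 0) := by
    intro c c'
    simp only [α, Finset.sum_mul_sum]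
    rw [Finset.sum_comm]
    simp_rw [Finset.sum_comm (s := (univ : Finset (Fin s → C))), aux_prob]
    rw [← hMdef]
    simp_rw [← Finset.mul_sum]
    congr 1
    have : ∀ i : Fin s, ∑ j : Fin s, (if i = j then if c = c' then 1 / M else 0 else 1 / M^2) =
        (s - 1) / M^2 + if c = c' then 1 / M else 0 := by
      intro i
      have : ∀ j : Fin s, (if i = j then if c = c' then 1 / M else 0 else 1 / M^2) =
         1 / M^2 + if i = j then (if c = c' then 1 / M else 0) - 1 / M^2 else 0 := by
        intro j; split_ifs <;> ring
      simp_rw [this]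
      rw [Finset.sum_add_distrib, Finset.sum_ite_eq]
      simp; ring
    simp_rw [this]
    simp
    split_ifs <;> ring
  have g1 : ∀ c, ∑ f, α f c = M ^ s * (s / M) := by
    intro c
    simp only [α]
    rw [Finset.sum_comm]
    have : ∀ i : Fin s, ∑ f : Fin s → C, (if f i = c then (1:ℝ) else 0) = M ^ s * (1 / M) := by
      intro i
      have := aux_prob i i c c
      rw [if_pos rfl, if_pos rfl, ← hMdef] at this
      rw [← this]
      refine Finset.sum_congr rfl fun f _ => ?_
      split_ifs <;> simp
    simp_rw [this]
    simp; ring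
  have e1 : ∑ Φ, N Φ = M * (M ^ s * (s / M))^3 := by
    simp only [N]
    rw [Finset.sum_comm]
    have : ∀ c, ∑ Φ : Fin 3 → Fin s → C, ∏ k, α (Φ k) c = (M ^ s * (s / M))^3 := by
      intro c
      rw [← g1 c, Fintype.sum_pow]
    simp_rw [this]
    simp [hMdef]
  have e2 : ∑ Φ, N Φ ^ 2 = ∑ c : C, ∑ c' : C, (M ^ s * (s * (s - 1) / M^2 + if c = c' then s / M else 0))^3 := by
    simp only [N, sq, Finset.sum_mul_sum, ← Finset.prod_mul_distrib]
    rw [Finset.sum_comm]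
    refine Finset.sum_congr rfl fun c _ => ?_
    rw [Finset.sum_comm]
    refine Finset.sum_congr rfl fun c' _ => ?_
    rw [← Fintype.sum_pow (fun f => α f c * α f c'), g2]
    simp [sq]
  have hs1 : (1:ℝ) ≤ s := by exact_mod_cast hs
  have e3 : ∑ Φ, N Φ ^ 2 ≤ M^(3*s) * (M^2 * (s^2/M^2)^3 + M * ((s^2/M^2 + s / M)^3 - (s^2/M^2)^3)) := by
    rw [e2]
    have hle : (s:ℝ) * (s - 1) / M^2 ≤ s^2/M^2 := by
      gcongr; nlinarith
    have h0 : 0 ≤ (s:ℝ) * (s - 1) / M^2 := by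
      have : (0:ℝ) ≤ s - 1 := by linarith
      positivity
    calc _ ≤ ∑ c : C, ∑ c' : C, M^(3*s) * ((s^2/M^2)^3 + if c = c' then (s^2/M^2 + s / M)^3 - (s^2/M^2)^3 else 0) := by
          refine Finset.sum_le_sum fun c _ => Finset.sum_le_sum fun c' _ => ?_
          rw [mul_pow, ← pow_mul, mul_comm s 3]
          gcongr
          split_ifs with h
          · have : ((s:ℝ) * (s - 1) / M^2 + s / M)^3 ≤ (s^2/M^2 + s / M)^3 := by gcongr
            linarith
          · simp only [add_zero]; gcongr
      _ = _ := by
          simp_rw [← Finset.mul_sum, Finset.sum_add_distrib, Finset.sum_ite_eq]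
          simp [← hMdef]; left; ring
  have cs : (∑ Φ, N Φ)^2 ≤ (B.card : ℝ) * ∑ Φ, N Φ ^ 2 := by
    have h1 : ∑ Φ, N Φ = ∑ Φ ∈ B, N Φ := by
      symm
      apply Finset.sum_subset (Finset.subset_univ _)
      intro Φ _ hΦ
      simp only [hB, Finset.mem_filter, Finset.mem_univ, true_and, not_exists, not_forall] at hΦ
      refine Finset.sum_eq_zero fun c _ => ?_
      obtain ⟨k, hk⟩ := hΦ c
      apply Finset.prod_eq_zero (Finset.mem_univ k)
      exact Finset.sum_eq_zero fun i _ => if_neg (hk i)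
    rw [h1]
    refine (sq_sum_le_card_mul_sum_sq).trans ?_
    gcongr
    exact Finset.subset_univ _
  have := cs.trans (mul_le_mul_of_nonneg_left e3 (by positivity))
  rw [e1] at this
  rw [div_le_iff₀ (by positivity)]
  have hpos : 0 < (s:ℝ)^6 / M^4 * M^(3*s) := by positivity
  refine le_of_mul_le_mul_left ?_ hpos
  calc _ = (M * (M ^ s * (s / M)) ^ 3) ^ 2 := by
        field_simp; ring
    _ ≤ _ := this
    _ = _ := by
        field_simp; ring

end Count

/-- grid cell -/
def cell (m : ℕ) (c : Fin 2 → Fin m) : Set E2 :=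
  qbox (fun i => (c i : ℕ) / (m : ℝ)) (fun i => ((c i : ℕ) + 1) / (m : ℝ))

lemma mem_cell {m : ℕ} {c : Fin 2 → Fin m} {x : E2} :
    x ∈ cell m c ↔ ∀ i, ((c i : ℕ) : ℝ) / m ≤ x i ∧ x i < ((c i : ℕ) + 1) / (m : ℝ) := by
  constructor
  · intro h i; exact h i trivial
  · intro h i _; exact h i

lemma cell_vol_s5 {m : ℕ} (hm : 0 < m) (c : Fin 2 → Fin m) :
    (volume.restrict unitSquare) (cell m c) = ENNReal.ofReal (1 / (m:ℝ)^2) := by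
  have hm' : (0:ℝ) < m := by positivity
  rw [Measure.restrict_eq_self, cell, qbox_vol]
  · have : ∀ i, (((c i : ℕ) : ℝ) + 1) / m - (c i : ℕ) / m = 1 / m := by
      intro i; ring
    simp only [this]
    rw [Finset.prod_const, ← ENNReal.ofReal_pow (by positivity)]
    simp
  · intro x hx i
    have h := mem_cell.1 hx i
    have h1 : (((c i : ℕ) : ℝ) + 1) ≤ m := by exact_mod_cast (c i).2
    refine ⟨le_trans (by positivity) h.1, h.2.le.trans ?_⟩
    rw [div_le_one hm']; exact h1

lemma cell_inj {m : ℕ} (hm : 0 < m) {c c' : Fin 2 → Fin m} {x : E2} (h : x ∈ cell m c)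
    (h' : x ∈ cell m c') : c = c' := by
  have hm' : (0:ℝ) < m := by positivity
  ext i
  have h1 := mem_cell.1 h i
  have h2 := mem_cell.1 h' i
  rw [div_le_iff₀ hm', lt_div_iff₀ hm'] at h1 h2
  have a1 : ((c i : ℕ) : ℝ) < (c' i : ℕ) + 1 := by linarith
  have a2 : ((c' i : ℕ) : ℝ) < (c i : ℕ) + 1 := by linarith
  norm_cast at a1 a2
  omega

lemma cell_dist_s5 {m : ℕ} (hm : 0 < m) {r : ℝ} (hr : 0 < r) (hmr : 2 / r ≤ m) {c : Fin 2 → Fin m} {x y : E2} (h : x ∈ cell m c)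
    (h' : y ∈ cell m c) : dist x y ≤ r := by
  have hm' : (0:ℝ) < m := by positivity
  have hd : ∀ i, dist (x i) (y i) ^ 2 ≤ (r/2)^2 := by
    intro i
    have h1 := mem_cell.1 h i
    have h2 := mem_cell.1 h' i
    have h3 : 1 / (m:ℝ) ≤ r / 2 := by
      rw [div_le_iff₀ hr] at hmr
      rw [div_le_div_iff₀ hm' (by norm_num)]; linarith
    have h4 : (((c i : ℕ) : ℝ) + 1) / m = (c i : ℕ) / m + 1 / m := by ring
    have : dist (x i) (y i) ≤ r / 2 := by
      rw [Real.dist_eq, abs_le]; constructor <;> linarith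
    gcongr
  rw [EuclideanSpace.dist_eq, Fin.sum_univ_two]
  apply Real.sqrt_le_iff.2 ⟨hr.le, ?_⟩
  have := hd 0; have := hd 1
  nlinarith

lemma lower_bound {n s m : ℕ} (hs : 0 < s) (hsn : 3 * s ≤ n) (hm : 0 < m) {r : ℝ} (hr : 0 < r)
    (hmr : 2 / r ≤ m) :
    ENNReal.ofReal (1 / (1 + 3 / s + 3 * (m:ℝ)^2 / s^2 + ((m:ℝ)^2)^2 / s^3)) ≤
    sqMeasure n {x | ∃ S : Finset (Fin n), (geomGraph n r x).IsNClique 3 S} := by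
  classical
  have : Nonempty (Fin m) := ⟨⟨0, hm⟩⟩
  have hm' : (0:ℝ) < m := by positivity
  have hc := second_moment hs (C := Fin 2 → Fin m)
  have hcard : (Fintype.card (Fin 2 → Fin m) : ℝ) = (m:ℝ)^2 := by simp
  rw [hcard] at hc
  set B := Finset.univ.filter (fun Φ : Fin 3 → Fin s → (Fin 2 → Fin m) => ∃ c, ∀ k, ∃ i, Φ k i = c) with hB
  obtain ⟨e⟩ : Nonempty (Fin 3 × Fin s ↪ Fin n) :=
    Function.Embedding.nonempty_of_card_le (by simpa using hsn)
  let bx : (Fin 3 → Fin s → (Fin 2 → Fin m)) → Set (Fin 3 × Fin s → E2) :=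
    fun Φ => Set.univ.pi fun p => cell m (Φ p.1 p.2)
  have hbm : ∀ Φ, MeasurableSet (bx Φ) := fun Φ => MeasurableSet.univ_pi fun p => qbox_meas _ _
  have hU : MeasurableSet (⋃ Φ ∈ B, bx Φ) := Finset.measurableSet_biUnion _ fun Φ _ => hbm Φ
  have h1 : MeasurePreserving (fun (x : Fin n → E2) (k : Fin 3 × Fin s) => x (e k)) (sqMeasure n)
      (Measure.pi fun _ => volume.restrict unitSquare) :=
    ⟨by fun_prop, map_precomp e e.injective⟩
  have hv : ∀ Φ, (Measure.pi fun _ : Fin 3 × Fin s => (volume : Measure E2).restrict unitSquare) (bx Φ)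
      = ENNReal.ofReal ((1 / (m:ℝ)^2)^(3 * s)) := by
    intro Φ
    rw [Measure.pi_pi]
    simp only [cell_vol_s5 hm]
    rw [Finset.prod_const, ← ENNReal.ofReal_pow (by positivity)]
    simp
  calc _ ≤ ENNReal.ofReal (B.card * (1 / (m:ℝ)^2)^(3 * s)) := by
        apply ENNReal.ofReal_le_ofReal
        rw [one_div_pow, mul_one_div, le_div_iff₀ (by positivity), one_div_mul_eq_div]
        exact hc
    _ = ∑ Φ ∈ B, (Measure.pi fun _ : Fin 3 × Fin s => (volume : Measure E2).restrict unitSquare) (bx Φ) := by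
        simp only [hv]
        rw [Finset.sum_const, ENNReal.ofReal_mul (by positivity)]
        simp
    _ = (Measure.pi fun _ : Fin 3 × Fin s => (volume : Measure E2).restrict unitSquare) (⋃ Φ ∈ B, bx Φ) := by
        rw [measure_biUnion_finset _ fun Φ _ => hbm Φ]
        intro Φ _ Ψ _ hne
        refine Set.disjoint_left.2 fun x hx hx' => hne ?_
        funext k i
        exact cell_inj hm (hx (k, i) trivial) (hx' (k, i) trivial)
    _ = _ := (h1.measure_preimage hU.nullMeasurableSet).symm
    _ ≤ _ := by
        apply measure_mono
        intro x hx
        simp only [Set.mem_preimage, Set.mem_iUnion] at hx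
        obtain ⟨Φ, hΦ, hx⟩ := hx
        obtain ⟨c, hc⟩ := (Finset.mem_filter.1 hΦ).2
        choose i hi using hc
        have hk : ∀ k, x (e (k, i k)) ∈ cell m c := by
          intro k
          have := hx (k, i k) trivial
          change x (e (k, i k)) ∈ cell m (Φ k (i k)) at this
          rwa [hi] at this
        have hadj : ∀ k l, k ≠ l → (geomGraph n r x).Adj (e (k, i k)) (e (l, i l)) := by
          intro k l hkl
          refine ⟨fun h => hkl ?_, cell_dist_s5 hm hr hmr (hk k) (hk l)⟩
          exact congrArg Prod.fst (e.injective h)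
        exact ⟨_, SimpleGraph.is3Clique_iff.2 ⟨_, _, _, hadj 0 1 (by decide), hadj 0 2 (by decide),
          hadj 1 2 (by decide), rfl⟩⟩

lemma part2 (r : ℕ → ℝ) (hr : ∀ n, 0 < r n)
    (h : Tendsto (fun n : ℕ => (n : ℝ) ^ ((3 : ℝ) / 4) * r n) atTop atTop) :
      Tendsto
        (fun n : ℕ => sqMeasure n
          {x | ∃ S : Finset (Fin n), (geomGraph n (r n) x).IsNClique 3 S})
        atTop (nhds 1) := by
  -- the error bound
  let y : ℕ → ℝ := fun n => ((n : ℝ) ^ ((3 : ℝ) / 4) * r n)⁻¹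
  have hy : Tendsto y atTop (nhds 0) := h.inv_tendsto_atTop
  have hn : Tendsto (fun n : ℕ => ((n:ℝ))⁻¹) atTop (nhds 0) := tendsto_inv_atTop_nhds_zero_nat
  let u : ℕ → ℝ := fun n => 216 * (128 * y n ^ 4 + 8 * ((n:ℝ)⁻¹)^3)
  have hu : Tendsto u atTop (nhds 0) := by
    have := (((hy.pow 4).const_mul 128).add ((hn.pow 3).const_mul 8)).const_mul 216
    simpa [u] using this
  have hg : Tendsto (fun n : ℕ => ENNReal.ofReal (1 / (1 + 5 * (6 * (n:ℝ)⁻¹) + 3 * u n))) atTop (nhds 1) := by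
    have h1 : Tendsto (fun n : ℕ => 1 + 5 * (6 * (n:ℝ)⁻¹) + 3 * u n) atTop (nhds 1) := by
      have := (((hn.const_mul 6).const_mul 5).const_add 1).add (hu.const_mul 3)
      simpa using this
    have := ENNReal.tendsto_ofReal ((tendsto_const_nhds (x := (1:ℝ))).div h1 one_ne_zero)
    simpa using this
  refine tendsto_of_tendsto_of_tendsto_of_le_of_le' hg tendsto_const_nhds ?_ (Eventually.of_forall fun n => prob_le_one)
  filter_upwards [eventually_ge_atTop 3] with n hn3
  have hr0 := hr n
  have hm : 0 < ⌈2 / r n⌉₊ := Nat.ceil_pos.2 (by positivity)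
  refine le_trans ?_ (lower_bound (s := n / 3) (m := ⌈2 / r n⌉₊) (by omega) (by omega) hm (hr n) (Nat.le_ceil _))
  apply ENNReal.ofReal_le_ofReal
  have hml : (⌈2 / r n⌉₊ : ℝ) ≤ 2 / r n + 1 := (Nat.ceil_lt_add_one (by positivity)).le
  have hsl : (n:ℝ) / 6 ≤ (n / 3 : ℕ) := by
    have : n ≤ 6 * (n / 3) := by omega
    have : (n:ℝ) ≤ 6 * (n / 3 : ℕ) := by exact_mod_cast this
    linarith
  set m : ℝ := (⌈2 / r n⌉₊ : ℝ)
  set s : ℝ := ((n / 3 : ℕ) : ℝ)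
  have hm0 : 0 < m := by positivity
  have hn0 : (0:ℝ) < n := by positivity
  have hs0 : 0 < s := by linarith [show 0 < (n:ℝ)/6 by positivity]
  have b1 : 1 / s ≤ 6 * (n:ℝ)⁻¹ := by
    calc 1 / s ≤ 1 / ((n:ℝ)/6) := by gcongr
      _ = _ := by field_simp
  have hy4 : y n ^ 4 = 1 / (n^3 * r n ^ 4) := by
    simp only [y]
    rw [inv_pow, mul_pow, ← Real.rpow_natCast ((n:ℝ)^_), ← Real.rpow_mul (by positivity)]
    norm_num
  have b2 : (m^2)^2 / s^3 ≤ u n := by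
    have h4 : (2 / r n + 1)^4 ≤ 8 * ((2 / r n)^4 + 1) := by
      have : ∀ z : ℝ, (z + 1)^4 ≤ 8 * (z^4 + 1) := by
        intro z
        nlinarith [sq_nonneg (z-1), sq_nonneg (z^2-1), sq_nonneg (z^2 - z), sq_nonneg (z^2-2*z+1)]
      exact this _
    calc (m^2)^2 / s^3 = m^4 / s^3 := by ring
      _ ≤ (2 / r n + 1)^4 / ((n:ℝ)/6)^3 := by gcongr
      _ ≤ (8 * ((2 / r n)^4 + 1)) / ((n:ℝ)/6)^3 := by gcongr
      _ = u n := by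
        simp only [u, hy4]; field_simp; ring
  have b3 : m^2 / s^2 ≤ ((m^2)^2 / s^3 + 1 / s) / 2 := by
    have : ((m^2)^2 / s^3 + 1 / s) / 2 - m^2 / s^2 = (m^2 - s)^2 / (2 * s^3) := by
      field_simp; ring
    have : 0 ≤ (m^2 - s)^2 / (2 * s^3) := by positivity
    linarith
  have c1 : 3 / s = 3 * (1 / s) := by ring
  have c2 : 3 * m^2 / s^2 = 3 * (m^2 / s^2) := by ring
  apply one_div_le_one_div_of_le (by positivity)
  rw [c1, c2]
  have d1 : 0 ≤ (m^2)^2 / s^3 := by positivity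
  have d2 : 0 ≤ (n:ℝ)⁻¹ := by positivity
  linarith

theorem triangle_threshold (r : ℕ → ℝ) (hrpos : ∀ n, 0 < r n) :
    (Tendsto (fun n : ℕ => (n : ℝ) ^ ((3 : ℝ) / 4) * r n) atTop (nhds 0) →
      Tendsto
        (fun n : ℕ => sqMeasure n
          {x | ∃ S : Finset (Fin n), (geomGraph n (r n) x).IsNClique 3 S})
        atTop (nhds 0)) ∧
    (Tendsto (fun n : ℕ => (n : ℝ) ^ ((3 : ℝ) / 4) * r n) atTop atTop →
      Tendsto
        (fun n : ℕ => sqMeasure n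
          {x | ∃ S : Finset (Fin n), (geomGraph n (r n) x).IsNClique 3 S})
        atTop (nhds 1)) := by
  exact ⟨part1 r hrpos, part2 r hrpos⟩
end
end

section
/- Let r : ℕ → ℝ be a positive function with r(n)·n^{2/3} → ∞ as n → ∞. Then the probability that the random geometric graph G(n, r(n)) has two crossing edges (i.e., is not plane) tends to 1 as n → ∞. -/
open MeasureTheory Filter

noncomputable section

/-- Two segments `[a,b]` and `[c,d]` cross if they have a common point that is interior to
both segments, i.e. lies on each segment and is distinct from its endpoints. -/
def Crosses (a b c d : EuclideanSpace ℝ (Fin 2)) : Prop :=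
  ∃ p, (p ∈ segment ℝ a b ∧ p ≠ a ∧ p ≠ b) ∧ (p ∈ segment ℝ c d ∧ p ≠ c ∧ p ≠ d)

/-- The (straight-line drawing of the) random geometric graph has two crossing edges. -/
def HasCrossing (n : ℕ) (r : ℝ) (x : Fin n → EuclideanSpace ℝ (Fin 2)) : Prop :=
  ∃ i j k l : Fin n, (geomGraph n r x).Adj i j ∧ (geomGraph n r x).Adj k l ∧
    ({i, j} : Finset (Fin n)) ≠ {k, l} ∧ Crosses (x i) (x j) (x k) (x l)

open ProbabilityTheory

theorem indep_curry {Ω ι κ 𝓧 : Type*} [MeasurableSpace Ω] {P : Measure Ω} [MeasurableSpace 𝓧]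
    {X : ι → κ → Ω → 𝓧} (mX : ∀ i j, Measurable (X i j))
    (h : iIndepFun (fun (p : ι × κ) ω => X p.1 p.2 ω) P) :
    iIndepFun (fun i ω => (fun j => X i j ω)) P := by
  have := h.isProbabilityMeasure
  have : ∀ i j, IsProbabilityMeasure (P.map (X i j)) :=
    fun i j ↦ Measure.isProbabilityMeasure_map (mX i j).aemeasurable
  have : ∀ i, IsProbabilityMeasure (P.map (fun ω ↦ (X i · ω))) :=
    fun i ↦ Measure.isProbabilityMeasure_map (Measurable.aemeasurable (by fun_prop))
  have h2 : ∀ i, iIndepFun (X i) P := fun i =>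
    h.precomp (g := fun j => (i, j)) (fun a b hab => by simpa using hab)
  have e : (MeasurableEquiv.curry ι κ 𝓧) ∘ (fun ω p ↦ X p.1 p.2 ω) = fun ω i j ↦ X i j ω := by
    ext; rfl
  rw [iIndepFun_iff_map_fun_eq_infinitePi_map (by fun_prop), ← e,
    ← Measure.map_map (by fun_prop) (by fun_prop),
    (iIndepFun_iff_map_fun_eq_infinitePi_map (by fun_prop)).1 h,
    Measure.infinitePi_map_curry (fun i j ↦ P.map (X i j))]
  congrm Measure.infinitePi fun i ↦ ?_
  rw [(iIndepFun_iff_map_fun_eq_infinitePi_map (by fun_prop)).1 (h2 i)]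

/-- number of points in `S` -/
def cnt {𝓧 : Type*} {m : ℕ} (S : Set 𝓧) (y : Fin m → 𝓧) : ℝ := ∑ j, S.indicator 1 (y j)

theorem cnt_meas {𝓧 : Type*} [MeasurableSpace 𝓧] {m : ℕ} {S : Set 𝓧} (hS : MeasurableSet S) :
    Measurable (cnt (m := m) S) := by
  unfold cnt
  refine Finset.measurable_fun_sum _ fun j _ => ?_
  exact (measurable_one.indicator hS).comp (measurable_pi_apply j)

theorem ind_bd {𝓧 : Type*} (S : Set 𝓧) (x : 𝓧) :
    0 ≤ S.indicator (1 : 𝓧 → ℝ) x ∧ S.indicator (1 : 𝓧 → ℝ) x ≤ 1 := by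
  by_cases h : x ∈ S <;> simp [h]

theorem cnt_nonneg {𝓧 : Type*} {m : ℕ} (S : Set 𝓧) (y : Fin m → 𝓧) : 0 ≤ cnt S y :=
  Finset.sum_nonneg fun j _ => (ind_bd S (y j)).1

theorem cnt_le {𝓧 : Type*} {m : ℕ} (S : Set 𝓧) (y : Fin m → 𝓧) : cnt S y ≤ m := by
  refine (Finset.sum_le_sum fun j _ => (ind_bd S (y j)).2).trans ?_
  simp

theorem integrable_of_bd {Ω : Type*} [MeasurableSpace Ω] {P : Measure Ω} [IsProbabilityMeasure P]
    {f : Ω → ℝ} (hf : Measurable f) (C : ℝ) (h0 : ∀ ω, 0 ≤ f ω) (h : ∀ ω, f ω ≤ C) :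
    Integrable f P :=
  Integrable.of_bound hf.aestronglyMeasurable C
    (Eventually.of_forall fun ω => by rw [Real.norm_eq_abs, abs_of_nonneg (h0 ω)]; exact h ω)

section
variable {Ω 𝓧 : Type*} [MeasurableSpace Ω] {P : Measure Ω} [IsProbabilityMeasure P]
  [MeasurableSpace 𝓧] {m : ℕ}

theorem int_ind {X : Ω → 𝓧} (mX : Measurable X) {S : Set 𝓧} (hS : MeasurableSet S) {a : ℝ}
    (ha : P.real (X ⁻¹' S) = a) : ∫ ω, S.indicator (1 : 𝓧 → ℝ) (X ω) ∂P = a := by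
  rw [← ha, ← integral_indicator_one (mX hS)]
  rfl

theorem cnt_mean {X : Fin m → Ω → 𝓧} (mX : ∀ j, Measurable (X j)) {S : Set 𝓧}
    (hS : MeasurableSet S) {a : ℝ} (ha : ∀ j, P.real (X j ⁻¹' S) = a) :
    ∫ ω, cnt S (fun j => X j ω) ∂P = m * a := by
  unfold cnt
  rw [integral_finsetSum]
  · simp [int_ind (mX _) hS (ha _)]
  · intro j _
    exact integrable_of_bd ((measurable_one.indicator hS).comp (mX j)) 1
      (fun ω => (ind_bd S _).1) (fun ω => (ind_bd S _).2)

theorem cnt_mul {X : Fin m → Ω → 𝓧} (mX : ∀ j, Measurable (X j)) (hi : iIndepFun X P) {S T : Set 𝓧}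
    (hS : MeasurableSet S) (hT : MeasurableSet T) {a : ℝ} (ha : ∀ j, P.real (X j ⁻¹' S) = a)
    (hb : ∀ j, P.real (X j ⁻¹' T) = a) (d : ℝ)
    (hd : ∀ j, ∫ ω, S.indicator (1 : 𝓧 → ℝ) (X j ω) * T.indicator (1 : 𝓧 → ℝ) (X j ω) ∂P ≤ d) :
    ∫ ω, cnt S (fun j => X j ω) * cnt T (fun j => X j ω) ∂P ≤ (m * a) ^ 2 + m * d := by
  unfold cnt
  have e : ∀ ω, (∑ j, S.indicator (1 : 𝓧 → ℝ) (X j ω)) * (∑ j, T.indicator (1 : 𝓧 → ℝ) (X j ω))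
      = ∑ i, ∑ j, S.indicator (1 : 𝓧 → ℝ) (X i ω) * T.indicator (1 : 𝓧 → ℝ) (X j ω) :=
    fun ω => Finset.sum_mul_sum _ _ _ _
  simp_rw [e]
  have hint : ∀ i j, Integrable
      (fun ω => S.indicator (1 : 𝓧 → ℝ) (X i ω) * T.indicator (1 : 𝓧 → ℝ) (X j ω)) P := by
    intro i j
    refine integrable_of_bd (((measurable_one.indicator hS).comp (mX i)).mul
      ((measurable_one.indicator hT).comp (mX j))) 1 (fun ω => ?_) (fun ω => ?_)
    · exact mul_nonneg (ind_bd S _).1 (ind_bd T _).1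
    · exact mul_le_one₀ (ind_bd S _).2 (ind_bd T _).1 (ind_bd T _).2
  rw [integral_finsetSum _ (fun i _ => integrable_finsetSum _ fun j _ => hint i j)]
  simp_rw [fun i => integral_finsetSum (μ := P) Finset.univ (fun j _ => hint i j)]
  have hb' : ∀ i j, ∫ ω, S.indicator (1 : 𝓧 → ℝ) (X i ω) * T.indicator (1 : 𝓧 → ℝ) (X j ω) ∂P
      ≤ a ^ 2 + if i = j then d else 0 := by
    intro i j
    by_cases h : i = j
    · subst h
      have := hd i
      simp only [if_true]
      nlinarith [sq_nonneg a]
    · rw [(hi.indepFun h).integral_fun_comp_mul_comp (mX i).aemeasurable (mX j).aemeasurable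
        (measurable_one.indicator hS).aestronglyMeasurable
        (measurable_one.indicator hT).aestronglyMeasurable, int_ind (mX i) hS (ha i),
        int_ind (mX j) hT (hb j)]
      simp [h, sq]
  refine (Finset.sum_le_sum fun i _ => Finset.sum_le_sum fun j _ => hb' i j).trans (le_of_eq ?_)
  simp [Finset.sum_add_distrib]
  ring

theorem second_moment_s11 {C : Type*} [Fintype C] {X : Fin 4 → Fin m → Ω → 𝓧}
    (mX : ∀ i j, Measurable (X i j))
    (h : iIndepFun (fun (p : Fin 4 × Fin m) ω => X p.1 p.2 ω) P)
    {S : C → Fin 4 → Set 𝓧} (hS : ∀ c i, MeasurableSet (S c i)) {a : ℝ} 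
    (ha : ∀ c i j, P.real (X i j ⁻¹' S c i) = a)
    (hdis : ∀ c c' i, c ≠ c' → Disjoint (S c i) (S c' i)) (ha0 : 0 ≤ a) (hma : m * a ≤ 1) :
    P.real {ω | ∀ c, ∃ i, ∀ j, X i j ω ∉ S c i} * (Fintype.card C * (m * a) ^ 4) ≤ 16 := by
  classical
  have hY := indep_curry mX h
  have h2 : ∀ i, iIndepFun (X i) P := fun i =>
    h.precomp (g := fun j => (i, j)) (fun a b hab => by simpa using hab)
  have mY : ∀ i, Measurable (fun ω => (fun j => X i j ω)) := fun i => by fun_prop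
  set f : C → Fin 4 → Ω → ℝ := fun c i ω => cnt (S c i) (fun j => X i j ω) with hf
  have mf : ∀ c i, Measurable (f c i) := fun c i => (cnt_meas (hS c i)).comp (mY i)
  have f0 : ∀ c i ω, 0 ≤ f c i ω := fun c i ω => cnt_nonneg _ _
  have f1 : ∀ c i ω, f c i ω ≤ m := fun c i ω => cnt_le _ _
  set N : Ω → ℝ := fun ω => ∑ c, ∏ i, f c i ω with hN
  have mN : Measurable N :=
    Finset.measurable_fun_sum _ fun c _ => Finset.measurable_fun_prod _ fun i _ => mf c i
  have i1 : ∀ c, Integrable (fun ω => ∏ i, f c i ω) P := fun c =>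
    integrable_of_bd (Finset.measurable_fun_prod _ fun i _ => mf c i) ((m : ℝ) ^ 4)
      (fun ω => Finset.prod_nonneg fun i _ => f0 c i ω)
      (fun ω => (Finset.prod_le_prod (fun i _ => f0 c i ω) (fun i _ => f1 c i ω)).trans (by simp))
  have i2 : ∀ c c', Integrable (fun ω => ∏ i, (f c i ω * f c' i ω)) P := fun c c' =>
    integrable_of_bd (Finset.measurable_fun_prod _ fun i _ => (mf c i).mul (mf c' i))
      (((m : ℝ) * m) ^ 4)
      (fun ω => Finset.prod_nonneg fun i _ => mul_nonneg (f0 c i ω) (f0 c' i ω))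
      (fun ω => (Finset.prod_le_prod (fun i _ => mul_nonneg (f0 c i ω) (f0 c' i ω))
        (fun i _ => mul_le_mul (f1 c i ω) (f1 c' i ω) (f0 _ _ _) (by positivity))).trans (by simp))
  set M : ℝ := Fintype.card C * (m * a) ^ 4 with hM
  have M0 : 0 ≤ M := by positivity
  have EN : ∫ ω, N ω ∂P = M := by
    rw [hN, integral_finsetSum _ (fun c _ => i1 c)]
    have : ∀ c, ∫ ω, ∏ i, f c i ω ∂P = (m * a) ^ 4 := by
      intro c
      have := hY.integral_fun_prod_comp (f := fun i => cnt (S c i)) (fun i => (mY i).aemeasurable)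
        (fun i => (cnt_meas (hS c i)).aestronglyMeasurable)
      rw [hf]
      rw [this]
      simp [cnt_mean (mX _) (hS _ _) (ha _ _)]
    simp [this, hM]
  have sqN : ∀ ω, N ω ^ 2 = ∑ c, ∑ c', ∏ i, (f c i ω * f c' i ω) := by
    intro ω
    rw [sq, hN, Finset.sum_mul_sum]
    simp_rw [Finset.prod_mul_distrib]
  have iN : Integrable N P := integrable_finsetSum _ fun c _ => i1 c
  have iN2 : Integrable (fun ω => N ω ^ 2) P := by
    simp_rw [sqN]
    exact integrable_finsetSum _ fun c _ => integrable_finsetSum _ fun c' _ => i2 c c'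
  have EN2 : ∫ ω, N ω ^ 2 ∂P ≤ M ^ 2 + 16 * M := by
    simp_rw [sqN]
    rw [integral_finsetSum _ (fun i _ => integrable_finsetSum _ fun j _ => i2 i j)]
    simp_rw [fun i => integral_finsetSum (μ := P) Finset.univ (fun j _ => i2 i j)]
    have hb : ∀ c c', ∫ ω, ∏ i, (f c i ω * f c' i ω) ∂P
        ≤ (m * a) ^ 8 + if c = c' then 16 * (m * a) ^ 4 else 0 := by
      intro c c'
      have := hY.integral_fun_prod_comp (f := fun i y => cnt (S c i) y * cnt (S c' i) y)
        (fun i => (mY i).aemeasurable)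
        (fun i => ((cnt_meas (hS c i)).mul (cnt_meas (hS c' i))).aestronglyMeasurable)
      rw [hf]
      rw [this]
      have nn : ∀ i, 0 ≤ ∫ ω, cnt (S c i) (fun j => X i j ω) * cnt (S c' i) (fun j => X i j ω) ∂P :=
        fun i => integral_nonneg fun ω => mul_nonneg (cnt_nonneg _ _) (cnt_nonneg _ _)
      by_cases hc : c = c'
      · subst hc
        have hle : ∀ i, ∫ ω, cnt (S c i) (fun j => X i j ω) * cnt (S c i) (fun j => X i j ω) ∂P
            ≤ 2 * (m * a) := by
          intro i
          have := cnt_mul (mX i) (h2 i) (hS c i) (hS c i) (ha c i) (ha c i) a (fun j => by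
            rw [← int_ind (mX i j) (hS c i) (ha c i j)]
            refine le_of_eq (integral_congr_ae (Eventually.of_forall fun ω => ?_))
            by_cases hx : X i j ω ∈ S c i <;> simp [hx])
          nlinarith [mul_nonneg (Nat.cast_nonneg (α := ℝ) m) ha0]
        refine (Finset.prod_le_prod (fun i _ => nn i) (fun i _ => hle i)).trans ?_
        have : 0 ≤ ((m : ℝ) * a) ^ 8 := by positivity
        simp only [Finset.prod_const, if_true, Finset.card_univ, Fintype.card_fin]
        nlinarith
      · have hle : ∀ i, ∫ ω, cnt (S c i) (fun j => X i j ω) * cnt (S c' i) (fun j => X i j ω) ∂P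
            ≤ (m * a) ^ 2 := by
          intro i
          have := cnt_mul (mX i) (h2 i) (hS c i) (hS c' i) (ha c i) (ha c' i) 0 (fun j => by
            refine le_of_eq (integral_eq_zero_of_ae (Eventually.of_forall fun ω => ?_))
            by_cases hx : X i j ω ∈ S c i
            · have := Set.disjoint_left.1 (hdis c c' i hc) hx
              simp [this]
            · simp [hx])
          simpa using this
        refine (Finset.prod_le_prod (fun i _ => nn i) (fun i _ => hle i)).trans ?_
        simp only [Finset.prod_const, hc, if_false, Finset.card_univ, Fintype.card_fin]
        nlinarith
    refine (Finset.sum_le_sum fun i _ => Finset.sum_le_sum fun j _ => hb i j).trans (le_of_eq ?_)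
    simp [Finset.sum_add_distrib, hM]
    ring
  have V : ∫ ω, (N ω - M) ^ 2 ∂P ≤ 16 * M := by
    have e : ∀ ω, (N ω - M) ^ 2 = N ω ^ 2 - (2 * M) * N ω + M ^ 2 := fun ω => by ring
    simp_rw [e]
    rw [integral_add (f := fun ω => N ω ^ 2 - 2 * M * N ω) (iN2.sub (iN.const_mul _))
      (integrable_const _),
      integral_sub iN2 (iN.const_mul _), integral_const_mul, EN]
    simp
    nlinarith
  have iV : Integrable (fun ω => (N ω - M) ^ 2) P := by
    have e : ∀ ω, (N ω - M) ^ 2 = N ω ^ 2 - (2 * M) * N ω + M ^ 2 := fun ω => by ring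
    simp_rw [e]
    exact (iN2.sub (iN.const_mul _)).add (integrable_const _)
  have mk := mul_meas_ge_le_integral_of_nonneg (μ := P) (f := fun ω => (N ω - M) ^ 2)
    (Eventually.of_forall fun ω => sq_nonneg _) iV (M ^ 2)
  have sub : P.real {ω | ∀ c, ∃ i, ∀ j, X i j ω ∉ S c i} ≤ P.real {ω | M ^ 2 ≤ (N ω - M) ^ 2} := by
    refine measureReal_mono fun ω hω => ?_
    have : N ω = 0 := by
      refine Finset.sum_eq_zero fun c _ => ?_
      obtain ⟨i, hi⟩ := hω c
      refine Finset.prod_eq_zero (Finset.mem_univ i) ?_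
      exact Finset.sum_eq_zero fun j _ => by simp [hi j]
    simp [this]
  rcases M0.eq_or_lt with h0 | h0
  · rw [← h0]; norm_num
  have : M * (P.real {ω | ∀ c, ∃ i, ∀ j, X i j ω ∉ S c i} * M) ≤ M * 16 := by
    nlinarith [mul_le_mul_of_nonneg_left sub (sq_nonneg M)]
  exact le_of_mul_le_mul_left this h0
end

theorem crosses_of {A B C D : EuclideanSpace ℝ (Fin 2)} {u v u' v' : ℝ} 
    (hA0 : A 0 < u) (hB0 : v < B 0) (hA1 : u' < A 1) (hA1' : A 1 < v') (hB1 : u' < B 1)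
    (hB1' : B 1 < v') (hC1 : C 1 < u') (hD1 : v' < D 1) (hC0 : u < C 0) (hC0' : C 0 < v)
    (hD0 : u < D 0) (hD0' : D 0 < v) : Crosses A B C D := by
  set dt : ℝ := (B 0 - A 0) * (D 1 - C 1) - (B 1 - A 1) * (D 0 - C 0) with hdt
  set s' : ℝ := (C 0 - A 0) * (D 1 - C 1) - (C 1 - A 1) * (D 0 - C 0) with hs'
  set t' : ℝ := (C 0 - A 0) * (B 1 - A 1) - (C 1 - A 1) * (B 0 - A 0) with ht'
  have s0 : 0 < s' := by
    have h1 : 0 < (D 0 - A 0) * (A 1 - C 1) := mul_pos (by linarith) (by linarith)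
    have h2 : 0 < (C 0 - A 0) * (D 1 - A 1) := mul_pos (by linarith) (by linarith)
    rw [hs']; nlinarith
  have s1 : s' < dt := by
    have h1 : 0 < (B 0 - D 0) * (B 1 - C 1) := mul_pos (by linarith) (by linarith)
    have h2 : 0 < (B 0 - C 0) * (D 1 - B 1) := mul_pos (by linarith) (by linarith)
    rw [hs', hdt]; nlinarith
  have t0 : 0 < t' := by
    have h1 : 0 < (C 0 - A 0) * (B 1 - C 1) := mul_pos (by linarith) (by linarith)
    have h2 : 0 < (B 0 - C 0) * (A 1 - C 1) := mul_pos (by linarith) (by linarith)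
    rw [ht']; nlinarith
  have t1 : t' < dt := by
    have h1 : 0 < (D 0 - A 0) * (D 1 - B 1) := mul_pos (by linarith) (by linarith)
    have h2 : 0 < (B 0 - D 0) * (D 1 - A 1) := mul_pos (by linarith) (by linarith)
    rw [ht', hdt]; nlinarith
  have d0 : 0 < dt := s0.trans s1
  have sp : 0 < s' / dt := div_pos s0 d0
  have sl : s' / dt < 1 := (div_lt_one d0).2 s1
  have tp : 0 < t' / dt := div_pos t0 d0
  have tl : t' / dt < 1 := (div_lt_one d0).2 t1
  have e : A + (s' / dt) • (B - A) = C + (t' / dt) • (D - C) := by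
    ext i
    fin_cases i
    · simp
      field_simp
      rw [hs', ht', hdt]; ring
    · simp
      field_simp
      rw [hs', ht', hdt]; ring
  refine ⟨A + (s' / dt) • (B - A), ⟨?_, ?_, ?_⟩, ?_, ?_, ?_⟩
  · rw [segment_eq_image']
    exact ⟨_, ⟨sp.le, sl.le⟩, rfl⟩
  · intro h
    have := congrArg (fun z : EuclideanSpace ℝ (Fin 2) => z 0) h
    simp at this
    rcases this with h | h
    · rcases h with h | h <;> linarith
    · linarith
  · intro h
    have := congrArg (fun z : EuclideanSpace ℝ (Fin 2) => z 0) h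
    simp at this
    nlinarith
  · rw [e, segment_eq_image']
    exact ⟨_, ⟨tp.le, tl.le⟩, rfl⟩
  · rw [e]
    intro h
    have := congrArg (fun z : EuclideanSpace ℝ (Fin 2) => z 1) h
    simp at this
    rcases this with h | h
    · rcases h with h | h <;> linarith
    · linarith
  · rw [e]
    intro h
    have := congrArg (fun z : EuclideanSpace ℝ (Fin 2) => z 1) h
    simp at this
    nlinarith

/-- offsets of the four subcells -/
def off : Fin 4 → Fin 2 → ℝ := ![![0, 1], ![2, 1], ![1, 0], ![1, 2]]

theorem off_bd (i : Fin 4) (d : Fin 2) : 0 ≤ off i d ∧ off i d ≤ 2 := by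
  fin_cases i <;> fin_cases d <;> simp [off]

/-- subcells -/
def sub (k : ℕ) (c : Fin 2 → Fin k) (i : Fin 4) : Set (EuclideanSpace ℝ (Fin 2)) :=
  WithLp.ofLp ⁻¹' Set.pi Set.univ (fun d => Set.Ioo ((3 * ((c d : ℕ) : ℝ) + off i d) / (3 * k))
    ((3 * ((c d : ℕ) : ℝ) + off i d + 1) / (3 * k)))

theorem sub_meas (k : ℕ) (c : Fin 2 → Fin k) (i : Fin 4) : MeasurableSet (sub k c i) :=
  (PiLp.volume_preserving_ofLp (Fin 2)).measurable
    (MeasurableSet.univ_pi fun _ => measurableSet_Ioo)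

theorem sub_subset (k : ℕ) (hk : 0 < k) (c : Fin 2 → Fin k) (i : Fin 4) :
    sub k c i ⊆ unitSquare := by
  intro x hx d
  have hx := hx d (Set.mem_univ d)
  have hk' : (0 : ℝ) < 3 * k := by positivity
  have h1 : ((c d : ℕ) : ℝ) + 1 ≤ k := by exact_mod_cast (c d).2
  have h0 : (0 : ℝ) ≤ ((c d : ℕ) : ℝ) := by positivity
  have h2 := off_bd i d
  rw [Set.mem_Ioo, div_lt_iff₀ hk', lt_div_iff₀ hk'] at hx
  constructor
  · by_contra h
    nlinarith [hx.1, not_le.1 h]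
  · by_contra h
    nlinarith [hx.2, not_le.1 h]

theorem sub_vol (k : ℕ) (hk : 0 < k) (c : Fin 2 → Fin k) (i : Fin 4) :
    (volume.restrict unitSquare).real (sub k c i) = 1 / (9 * (k : ℝ) ^ 2) := by
  rw [measureReal_restrict_apply (sub_meas k c i), Set.inter_eq_left.2 (sub_subset k hk c i),
    measureReal_def, sub, (PiLp.volume_preserving_ofLp (Fin 2)).measure_preimage
      (MeasurableSet.univ_pi fun _ => measurableSet_Ioo).nullMeasurableSet, Real.volume_pi_Ioo]
  have hk' : (0 : ℝ) < k := by positivity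
  have : ∀ d, (3 * ((c d : ℕ) : ℝ) + off i d + 1) / (3 * k) - (3 * ((c d : ℕ) : ℝ) + off i d) / (3 * k)
     = 1 / (3 * k) := fun d => by field_simp; ring
  simp only [this, Fin.prod_univ_two, ENNReal.toReal_mul]
  rw [ENNReal.toReal_ofReal (by positivity)]
  field_simp
  norm_num

theorem sub_disj (k : ℕ) (c c' : Fin 2 → Fin k) (i : Fin 4) (h : c ≠ c') :
    Disjoint (sub k c i) (sub k c' i) := by
  rw [Set.disjoint_left]
  intro x hx hx'
  apply h
  ext d
  have hk : 0 < k := (c d).pos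
  have hk' : (0 : ℝ) < 3 * k := by positivity
  have hx := hx d (Set.mem_univ d)
  have hx' := hx' d (Set.mem_univ d)
  rw [Set.mem_Ioo, div_lt_iff₀ hk', lt_div_iff₀ hk'] at hx hx'
  have h1 : ((c d : ℕ) : ℝ) < (c' d : ℕ) + 1 := by linarith [hx.1, hx'.2]
  have h2 : ((c' d : ℕ) : ℝ) < (c d : ℕ) + 1 := by linarith [hx.2, hx'.1]
  have h1 : (c d : ℕ) < (c' d : ℕ) + 1 := by exact_mod_cast h1
  have h2 : (c' d : ℕ) < (c d : ℕ) + 1 := by exact_mod_cast h2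
  omega

instance : IsProbabilityMeasure
    ((volume : Measure (EuclideanSpace ℝ (Fin 2))).restrict unitSquare) := by
  constructor
  have : unitSquare = WithLp.ofLp ⁻¹' Set.pi Set.univ (fun _ : Fin 2 => Set.Icc (0 : ℝ) 1) := by
    ext x; simp only [unitSquare, Set.mem_setOf_eq, Set.mem_preimage, Set.mem_univ_pi]
  rw [Measure.restrict_apply_univ, this, (PiLp.volume_preserving_ofLp (Fin 2)).measure_preimage
      (MeasurableSet.univ_pi fun _ => measurableSet_Icc).nullMeasurableSet, volume_pi_pi]
  simp

instance (n : ℕ) : IsProbabilityMeasure (sqMeasure n) := by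
  unfold sqMeasure; infer_instance

theorem sub_dist (k : ℕ) (c : Fin 2 → Fin k) (i j : Fin 4)
    {x y : EuclideanSpace ℝ (Fin 2)} (hx : x ∈ sub k c i) (hy : y ∈ sub k c j) :
    dist x y ≤ 2 / k := by
  have hk : 0 < k := (c 0).pos
  have hk1 : (0 : ℝ) < k := by positivity
  have hk' : (0 : ℝ) < 3 * k := by positivity
  have : ∀ d, (x d - y d) ^ 2 ≤ (1 / k) ^ 2 := by
    intro d
    have hx := hx d (Set.mem_univ d)
    have hy := hy d (Set.mem_univ d)
    rw [Set.mem_Ioo, div_lt_iff₀ hk', lt_div_iff₀ hk'] at hx hy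
    have h2 := off_bd i d
    have h3 := off_bd j d
    apply sq_le_sq'
    · rw [← neg_div, div_le_iff₀ hk1]; linarith [hx.1, hy.2]
    · rw [le_div_iff₀ hk1]; linarith [hx.2, hy.1]
  rw [EuclideanSpace.dist_eq]
  apply Real.sqrt_le_iff.2 ⟨by positivity, ?_⟩
  simp only [Fin.sum_univ_two, Real.dist_eq, sq_abs]
  have e : (2 / (k : ℝ)) ^ 2 = 4 * (1 / k) ^ 2 := by ring
  rw [e]
  nlinarith [this 0, this 1, sq_nonneg (1 / (k : ℝ))]

theorem hasCrossing_of {n k m : ℕ} {r : ℝ} (hr : 2 / k ≤ r) (e : Fin 4 × Fin m → Fin n)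
    (he : Function.Injective e) (x : Fin n → EuclideanSpace ℝ (Fin 2)) (c : Fin 2 → Fin k)
    (h : ∀ i, ∃ j, x (e (i, j)) ∈ sub k c i) : HasCrossing n r x := by
  choose j hj using h
  have hk : 0 < k := (c 0).pos
  have hne : ∀ a b, a ≠ b → e (a, j a) ≠ e (b, j b) := fun a b hab h =>
    hab (congrArg Prod.fst (he h))
  refine ⟨e (0, j 0), e (1, j 1), e (2, j 2), e (3, j 3),
    ⟨hne _ _ (by decide), (sub_dist k c _ _ (hj 0) (hj 1)).trans hr⟩,
    ⟨hne _ _ (by decide), (sub_dist k c _ _ (hj 2) (hj 3)).trans hr⟩, ?_, ?_⟩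
  · intro hh
    have : e (0, j 0) ∈ ({e (2, j 2), e (3, j 3)} : Finset (Fin n)) := by rw [← hh]; simp
    simp only [Finset.mem_insert, Finset.mem_singleton] at this
    rcases this with h | h
    · exact hne _ _ (by decide) h
    · exact hne _ _ (by decide) h
  · have key : ∀ i d, (3 * ((c d : ℕ) : ℝ) + off i d) / (3 * k) < x (e (i, j i)) d ∧
       x (e (i, j i)) d < (3 * ((c d : ℕ) : ℝ) + off i d + 1) / (3 * k) :=
      fun i d => hj i d (Set.mem_univ d)
    have z0 := key 0 0
    have z1 := key 0 1
    have z2 := key 1 0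
    have z3 := key 1 1
    have z4 := key 2 0
    have z5 := key 2 1
    have z6 := key 3 0
    have z7 := key 3 1
    simp [off, add_assoc] at z0 z1 z2 z3 z4 z5 z6 z7
    norm_num at z0 z1 z2 z3 z4 z5 z6 z7
    exact crosses_of z0.2 z2.1 z1.1 z1.2 z3.1 z3.2 z5.2 z7.1 z4.1 z4.2 z6.1 z6.2

theorem prob_bound {n k m : ℕ} {r : ℝ} (hk : 0 < k) (hr : 2 / k ≤ r) (hmk : m ≤ 9 * k ^ 2)
    (hmn : 4 * m ≤ n) :
    (sqMeasure n).real {x | HasCrossing n r x}ᶜ *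
      ((k : ℝ) ^ 2 * (m * (1 / (9 * (k : ℝ) ^ 2))) ^ 4) ≤ 16 := by
  have hk1 : (0 : ℝ) < k := by positivity
  set e : Fin 4 × Fin m → Fin n := fun p => Fin.castLE hmn (finProdFinEquiv p) with he
  have hei : Function.Injective e :=
    (Fin.castLE_injective hmn).comp finProdFinEquiv.injective
  have hind : iIndepFun (fun (i : Fin n) (x : Fin n → EuclideanSpace ℝ (Fin 2)) => x i)
      (sqMeasure n) := iIndepFun_pi (X := fun _ x => x) (fun i => aemeasurable_id)
  have h := second_moment_s11 (P := sqMeasure n) (C := Fin 2 → Fin k)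
    (X := fun i j x => x (e (i, j))) (fun i j => measurable_pi_apply _)
    (hind.precomp hei) (S := sub k) (sub_meas k) (a := 1 / (9 * (k : ℝ) ^ 2))
    (fun c i j => by
      rw [← sub_vol k hk c i, measureReal_def, measureReal_def]
      congr 1
      exact (measurePreserving_eval (fun _ : Fin n => volume.restrict unitSquare)
        (e (i, j))).measure_preimage (sub_meas k c i).nullMeasurableSet)
    (fun c c' i h => sub_disj k c c' i h) (by positivity)
    (by
      have : (m : ℝ) ≤ 9 * k ^ 2 := by exact_mod_cast hmk
      rw [mul_one_div, div_le_one (by positivity)]; exact this)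
  have hc : (Fintype.card (Fin 2 → Fin k) : ℝ) = (k : ℝ) ^ 2 := by simp
  rw [hc] at h
  refine le_trans (mul_le_mul_of_nonneg_right (measureReal_mono ?_) (by positivity)) h
  intro x hx c
  by_contra! hh
  exact hx (hasCrossing_of hr e hei x c hh)

theorem plane_supercritical (r : ℕ → ℝ) (hrpos : ∀ n, 0 < r n)
    (hr : Tendsto (fun n : ℕ => r n * (n : ℝ) ^ ((2 : ℝ) / 3)) atTop atTop) :
    Tendsto (fun n : ℕ => sqMeasure n {x | HasCrossing n (r n) x}) atTop (nhds 1) := by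
  set q : ℕ → ℝ := fun n => 2 * (r n * (n : ℝ) ^ ((2 : ℝ) / 3))⁻¹ + (n : ℝ) ^ (-(1 / 6 : ℝ))
    + 2 * (n : ℝ) ^ (-(2 / 3 : ℝ)) with hq
  have hq0 : Tendsto q atTop (nhds 0) := by
    have h1 := (tendsto_inv_atTop_zero.comp hr).const_mul 2
    have h2 := (tendsto_rpow_neg_atTop (show (0 : ℝ) < 1 / 6 by norm_num)).comp
      (tendsto_natCast_atTop_atTop (R := ℝ))
    have h3 := ((tendsto_rpow_neg_atTop (show (0 : ℝ) < 2 / 3 by norm_num)).comp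
      (tendsto_natCast_atTop_atTop (R := ℝ))).const_mul 2
    simpa [Function.comp_def, hq] using (h1.add h2).add h3
  have hb0 : Tendsto (fun n => 1 - 16 * 9 ^ 4 * 8 ^ 4 * q n ^ 6) atTop (nhds 1) := by
    simpa using ((hq0.pow 6).const_mul (16 * 9 ^ 4 * 8 ^ 4)).const_sub 1
  have key : ∀ᶠ n in atTop, 1 - 16 * 9 ^ 4 * 8 ^ 4 * q n ^ 6 ≤
      (sqMeasure n).real {x | HasCrossing n (r n) x} := by
    filter_upwards [eventually_ge_atTop 8] with n hn
    have hn0 : (0 : ℝ) < n := by positivity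
    have hrn := hrpos n
    set k : ℕ := ⌈2 / r n⌉₊ + ⌈√(n : ℝ)⌉₊ with hk
    have k1 : 2 / r n ≤ k := by
      have := Nat.le_ceil (2 / r n); rw [hk]; push_cast
      have : (0 : ℝ) ≤ (⌈√(n : ℝ)⌉₊ : ℝ) := by positivity
      linarith
    have k2 : √(n : ℝ) ≤ k := by
      have := Nat.le_ceil (√(n : ℝ)); rw [hk]; push_cast
      have : (0 : ℝ) ≤ (⌈2 / r n⌉₊ : ℝ) := by positivity
      linarith
    have k3 : (k : ℝ) ≤ 2 / r n + √(n : ℝ) + 2 := by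
      have h1 := Nat.ceil_lt_add_one (show 0 ≤ 2 / r n by positivity)
      have h2 := Nat.ceil_lt_add_one (Real.sqrt_nonneg (n : ℝ))
      rw [hk]; push_cast; linarith
    have kpos' : (0 : ℝ) < k := lt_of_lt_of_le (by positivity) k1
    have kpos : 0 < k := by exact_mod_cast kpos'
    have kn : (n : ℝ) ≤ (k : ℝ) ^ 2 := (Real.sqrt_le_left kpos'.le).1 k2
    have kn' : n ≤ k ^ 2 := by exact_mod_cast kn
    set m : ℕ := n / 4 with hm
    have hm8 : n ≤ 8 * m := by omega
    have hm8' : (n : ℝ) ≤ 8 * m := by exact_mod_cast hm8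
    have B := prob_bound (n := n) (k := k) (m := m) (r := r n) kpos
      (by rw [div_le_iff₀ kpos']; rw [div_le_iff₀ hrn] at k1; linarith) (by omega) (by omega)
    set p := (sqMeasure n).real {x | HasCrossing n (r n) x}ᶜ with hp
    have hp0 : 0 ≤ p := measureReal_nonneg
    have kq : (k : ℝ) ≤ q n * (n : ℝ) ^ ((2 : ℝ) / 3) := by
      refine k3.trans (le_of_eq ?_)
      have hnp : (0 : ℝ) < (n : ℝ) ^ ((2 : ℝ) / 3) := by positivity
      have e1 : (n : ℝ) ^ (-(1 / 6 : ℝ)) * (n : ℝ) ^ ((2 : ℝ) / 3) = √(n : ℝ) := by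
        rw [← Real.rpow_add hn0, Real.sqrt_eq_rpow]; norm_num
      have e2 : (n : ℝ) ^ (-(2 / 3 : ℝ)) * (n : ℝ) ^ ((2 : ℝ) / 3) = 1 := by
        rw [← Real.rpow_add hn0]; norm_num
      simp only [hq, add_mul, mul_assoc, e1, e2]
      field_simp
    have k6 : (k : ℝ) ^ 6 ≤ q n ^ 6 * (n : ℝ) ^ 4 := by
      have := pow_le_pow_left₀ kpos'.le kq 6
      rw [mul_pow, ← Real.rpow_natCast ((n : ℝ) ^ ((2 : ℝ) / 3)), ← Real.rpow_mul hn0.le] at this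
      norm_num at this
      exact_mod_cast this
    have B' : p * (m : ℝ) ^ 4 ≤ 16 * 9 ^ 4 * (k : ℝ) ^ 6 := by
      have e : (k : ℝ) ^ 2 * (m * (1 / (9 * (k : ℝ) ^ 2))) ^ 4 = (m : ℝ) ^ 4 / (9 ^ 4 * (k : ℝ) ^ 6) := by
        field_simp
      rw [e, ← mul_div_assoc, div_le_iff₀ (by positivity)] at B
      linarith
    have n4 : (n : ℝ) ^ 4 ≤ 8 ^ 4 * (m : ℝ) ^ 4 := by
      rw [← mul_pow]; exact pow_le_pow_left₀ hn0.le hm8' 4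
    have fin : p ≤ 16 * 9 ^ 4 * 8 ^ 4 * q n ^ 6 := by
      have n4p : 0 < (n : ℝ) ^ 4 := by positivity
      refine le_of_mul_le_mul_right ?_ n4p
      nlinarith [mul_le_mul_of_nonneg_left n4 hp0]
    have tot : (1 : ℝ) ≤ (sqMeasure n).real {x | HasCrossing n (r n) x} + p := by
      have := measureReal_union_le (μ := sqMeasure n) {x | HasCrossing n (r n) x}
        {x | HasCrossing n (r n) x}ᶜ
      rwa [Set.union_compl_self, probReal_univ] at this
    linarith
  have hreal : Tendsto (fun n => (sqMeasure n).real {x | HasCrossing n (r n) x}) atTop (nhds 1) :=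
    tendsto_of_tendsto_of_tendsto_of_le_of_le' hb0 tendsto_const_nhds key
      (Eventually.of_forall fun n => measureReal_le_one)
  rw [← ENNReal.tendsto_toReal_iff (fun n => measure_ne_top _ _) ENNReal.one_ne_top]
  simpa [measureReal_def] using hreal
end
end
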